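/- arXiv:2506.00529 — 3 statements merged into one kernel-verified Lean document; each statement's English description precedes it below -/
import Mathlib

section
/- Let R be a commutative Noetherian ring, r ≥ 1 an integer, I_1,…,I_r ideals of R, J a nonzero ideal of R, and N ⊆ M finitely generated R-modules. Let f : K → L be an R-linear map between finitely generated R-modules and let F denote the associated coherent functor, F(X) := Hom_R(K,X) / {g ∘ f : g ∈ Hom_R(L,X)}. Then grade(J, F(M/I^n N)) stabilizes: there exists c ∈ ℕ^r such that grade(J, F(M/I^n N)) = grade(J, F(M/I^c N)) for all n ≥ c. -/
universe u

open CategoryTheory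

/-- The value of the coherent functor presented by `f : K →ₗ[R] L` on a module `X`:
`F(X) = Hom_R(K, X) / {g ∘ f : g ∈ Hom_R(L, X)}`. -/
abbrev coherentApply {R K L : Type u} [CommRing R] [AddCommGroup K] [Module R K]
    [AddCommGroup L] [Module R L] (f : K →ₗ[R] L)
    (X : Type u) [AddCommGroup X] [Module R X] : Type u :=
  (K →ₗ[R] X) ⧸ LinearMap.range (LinearMap.lcomp R X f)

/-- The product ideal `I^n = I_1^{n_1} ⋯ I_r^{n_r}`. -/
abbrev prodPow {R : Type u} [CommRing R] {r : ℕ} (I : Fin r → Ideal R)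
    (n : Fin r → ℕ) : Ideal R :=
  ∏ i, I i ^ n i

/-- `grade(J, X)`: the infimum in `ℕ∞` of the set `{i ∈ ℕ : Ext_R^i(R/J, X) ≠ 0}`. -/
noncomputable def gradeIdeal {R : Type u} [CommRing R] (J : Ideal R)
    (X : Type u) [AddCommGroup X] [Module R X] : ℕ∞ :=
  sInf {n : ℕ∞ | ∃ m : ℕ, n = m ∧
    Nontrivial (((Ext R (ModuleCat.{u} R) m).obj
      (Opposite.op (ModuleCat.of R (R ⧸ J)))).obj (ModuleCat.of R X))}

section ExtPart
open Opposite

lemma old_ext_iff {R : Type u} [CommRing R] (T X : ModuleCat.{u} R) (n : ℕ) :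
    Nontrivial (((Ext R (ModuleCat.{u} R) n).obj (Opposite.op T)).obj X) ↔
      Nontrivial (Abelian.Ext T X n) := by
  rw [← not_iff_not, not_nontrivial_iff_subsingleton, not_nontrivial_iff_subsingleton]
  let P := projectiveResolution T
  have h1 : Subsingleton (((Ext R (ModuleCat.{u} R) n).obj (Opposite.op T)).obj X) ↔
      ∀ f : P.complex.X n ⟶ X, P.complex.d (n+1) n ≫ f = 0 →
        ∃ g : P.complex.X (n-1) ⟶ X, P.complex.d n (n-1) ≫ g = f := by
    rw [← ModuleCat.isZero_iff_subsingleton, (P.isoExt n X).isZero_iff,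
      ← HomologicalComplex.exactAt_iff_isZero_homology]
    rw [HomologicalComplex.exactAt_iff' _ (n-1) n (n+1) (by cases n <;> simp) (by simp)]
    rw [ShortComplex.moduleCat_exact_iff]
    rfl
  rw [h1]
  constructor
  · intro h
    refine subsingleton_of_forall_eq 0 fun e => ?_
    obtain ⟨f, hf, rfl⟩ := P.extMk_surjective e (n+1) rfl
    obtain ⟨g, hg⟩ := h f hf
    cases n with
    | zero =>
      have : f = 0 := by
        rw [← hg]; simp
      subst this
      simp
    | succ n => exact (P.extMk_eq_zero_iff f _ rfl hf n rfl).2 ⟨g, hg⟩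
  · intro h f hf
    cases n with
    | zero =>
      refine ⟨0, ?_⟩
      have hh : Subsingleton (((ChainComplex.single₀ (ModuleCat.{u} R)).obj T).X 0 ⟶ X) := by
        have h3 : Subsingleton (T ⟶ X) := Abelian.Ext.homEquiv₀.symm.subsingleton
        exact h3
      rw [← P.exact₀.g_desc f hf, Subsingleton.elim (P.exact₀.desc f hf) 0,
        Limits.comp_zero, Limits.comp_zero]
    | succ n => exact (P.extMk_eq_zero_iff f _ rfl hf n rfl).1 (Subsingleton.elim _ _)


lemma coherent_subsingleton_iff {R K L : Type u} [CommRing R] [AddCommGroup K] [Module R K]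
    [AddCommGroup L] [Module R L] (f : K →ₗ[R] L)
    (X : Type u) [AddCommGroup X] [Module R X] :
    Subsingleton (coherentApply f X) ↔ ∀ φ : K →ₗ[R] X, ∃ ψ : L →ₗ[R] X, ψ ∘ₗ f = φ := by
  rw [Submodule.Quotient.subsingleton_iff, LinearMap.range_eq_top]
  rfl

lemma ext_eq_coherent {R : Type u} [CommRing R] [IsNoetherianRing R] (i : ℕ) :
    ∀ (T : Type u) [AddCommGroup T] [Module R T] [Module.Finite R T],
    ∃ (P : Type u) (_ : AddCommGroup P) (_ : Module R P) (_ : Module.Finite R P)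
      (Q : Type u) (_ : AddCommGroup Q) (_ : Module R Q) (_ : Module.Finite R Q)
      (g : P →ₗ[R] Q), ∀ (X : Type u) [AddCommGroup X] [Module R X],
      Subsingleton (Abelian.Ext (ModuleCat.of R T) (ModuleCat.of R X) i) ↔
        Subsingleton (coherentApply g X) := by
  induction i with
  | zero =>
    intro T _ _ _
    refine ⟨T, _, _, inferInstance, PUnit, _, _, inferInstance, 0, fun X _ _ => ?_⟩
    rw [coherent_subsingleton_iff, Abelian.Ext.homEquiv₀.subsingleton_congr]
    rw [ModuleCat.homEquiv.subsingleton_congr]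
    constructor
    · intro h φ
      exact ⟨0, Subsingleton.elim _ _⟩
    · intro h
      refine subsingleton_of_forall_eq 0 fun φ => ?_
      obtain ⟨ψ, rfl⟩ := h φ
      simp
  | succ i ih =>
    intro T _ _ _
    obtain ⟨N, _, _, _, _, f, surjf⟩ := Module.exists_finite_presentation R T
    let exac := LinearMap.shortExact_shortComplexKer surjf
    cases i with
    | zero =>
      refine ⟨LinearMap.ker f, _, _, inferInstance, N, _, _, inferInstance,
        (LinearMap.ker f).subtype, fun X _ _ => ?_⟩
      rw [coherent_subsingleton_iff]
      constructor
      · intro h φ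
        obtain ⟨e, he⟩ := Abelian.Ext.contravariant_sequence_exact₁ exac (ModuleCat.of R X)
          (Abelian.Ext.mk₀ (ModuleCat.ofHom φ)) (n₁ := 1) rfl (Subsingleton.elim _ _)
        obtain ⟨ψ, rfl⟩ := Abelian.Ext.homEquiv₀.symm.surjective e
        refine ⟨ψ.hom, ?_⟩
        simp only [Abelian.Ext.homEquiv₀_symm_apply, Abelian.Ext.mk₀_comp_mk₀] at he
        have := (Abelian.Ext.mk₀_bijective _ _).1 he
        exact congrArg ModuleCat.Hom.hom this
      · intro h
        refine subsingleton_of_forall_eq 0 fun e => ?_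
        obtain ⟨e', rfl⟩ := precomp_extClass_surjective_of_projective_X₂ (ModuleCat.of R X) exac 0 e
        obtain ⟨φ, rfl⟩ := Abelian.Ext.homEquiv₀.symm.surjective e'
        obtain ⟨ψ, hψ⟩ := h φ.hom
        have : φ = (LinearMap.shortComplexKer f).f ≫ ModuleCat.ofHom ψ := by
          ext1; exact hψ.symm
        subst this
        rw [Abelian.Ext.homEquiv₀_symm_apply, ← Abelian.Ext.mk₀_comp_mk₀]
        exact exac.extClass_comp_assoc (h := by lia) _
    | succ i =>
      obtain ⟨P, _, _, _, Q, _, _, _, g, hg⟩ := ih (LinearMap.ker f)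
      refine ⟨P, _, _, inferInstance, Q, _, _, inferInstance, g, fun X _ _ => ?_⟩
      rw [← hg]
      constructor
      · intro h
        refine subsingleton_of_forall_eq 0 fun e => ?_
        obtain ⟨e', he'⟩ := Abelian.Ext.contravariant_sequence_exact₁ exac (ModuleCat.of R X)
          e (add_comm _ _) (Subsingleton.elim _ _)
        rw [← he', Abelian.Ext.eq_zero_of_projective e', Abelian.Ext.comp_zero]
      · intro h
        exact (precomp_extClass_surjective_of_projective_X₂ (ModuleCat.of R X) exac
          (i+1)).subsingleton


/-- Part (3): if `1 - a` kills `X` for some `a ∈ J`, all Ext vanish. -/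
lemma ext_vanish_of_kill {R : Type u} [CommRing R] (J : Ideal R)
    (X : Type u) [AddCommGroup X] [Module R X] (a : R) (ha : a ∈ J)
    (h : ∀ x : X, (1 - a) • x = 0) (i : ℕ) :
    Subsingleton (Abelian.Ext (ModuleCat.of R (R ⧸ J)) (ModuleCat.of R X) i) := by
  refine subsingleton_of_forall_eq 0 fun e => ?_
  have h1 : (1 - a) • e = 0 := by
    rw [Abelian.Ext.smul_eq_comp_mk₀]
    have : (1 - a) • 𝟙 (ModuleCat.of R X) = 0 := by
      ext x; exact h x
    rw [this]; simp
  have h2 : a • e = 0 := by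
    have : a • 𝟙 (ModuleCat.of R (R ⧸ J)) = 0 := by
      ext
      change a • (Ideal.Quotient.mk J 1) = 0
      rw [← Ideal.Quotient.mk_eq_mk, ← Submodule.Quotient.mk_smul]
      simpa using Ideal.Quotient.eq_zero_iff_mem.2 ha
    calc a • e = (Abelian.Ext.mk₀ (a • 𝟙 (ModuleCat.of R (R ⧸ J)))).comp e (zero_add i) := by
          simp [Abelian.Ext.mk₀_smul]
      _ = 0 := by rw [this]; simp
  rw [sub_smul, h2, one_smul, sub_zero] at h1
  exact h1

lemma ext_pi_vanish {R : Type u} [CommRing R] (A : Type u) [AddCommGroup A] [Module R A]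
    (X : ModuleCat.{u} R) (i s : ℕ) (h : Subsingleton (Abelian.Ext (ModuleCat.of R A) X i)) :
    Subsingleton (Abelian.Ext (ModuleCat.of R (Fin s → A)) X i) := by
  refine subsingleton_of_forall_eq 0 fun e => ?_
  have : 𝟙 (ModuleCat.of R (Fin s → A)) = ∑ j : Fin s,
      ModuleCat.ofHom (LinearMap.proj j : (Fin s → A) →ₗ[R] A) ≫
      ModuleCat.ofHom (LinearMap.single R (fun _ => A) j) := by
    have h2 : (LinearMap.id : (Fin s → A) →ₗ[R] (Fin s → A)) =
      ∑ j, (LinearMap.single R (fun _ => A) j) ∘ₗ LinearMap.proj j := by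
      apply LinearMap.ext
      intro x
      rw [LinearMap.sum_apply]
      exact (Finset.univ_sum_single x).symm
    ext1
    rw [ModuleCat.hom_sum]
    exact h2
  rw [← Abelian.Ext.mk₀_id_comp e, this, Abelian.Ext.mk₀_sum, Abelian.Ext.sum_comp]
  refine Finset.sum_eq_zero fun j _ => ?_
  rw [← Abelian.Ext.mk₀_comp_mk₀_assoc]
  rw [Subsingleton.elim (Abelian.Ext.comp _ e _) 0]
  simp

lemma ext_vanish_of_torsion {R : Type u} [CommRing R] [IsNoetherianRing R] (J : Ideal R)
    (X : ModuleCat.{u} R) (d : ℕ)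
    (h : ∀ i ≤ d, Subsingleton (Abelian.Ext (ModuleCat.of R (R ⧸ J)) X i)) (i : ℕ) :
    i ≤ d → ∀ (T : Type u) [AddCommGroup T] [Module R T] [Module.Finite R T],
    (∀ a ∈ J, ∀ t : T, a • t = 0) → Subsingleton (Abelian.Ext (ModuleCat.of R T) X i) := by
  have key : ∀ (T : Type u) [AddCommGroup T] [Module R T] [Module.Finite R T],
    (∀ a ∈ J, ∀ t : T, a • t = 0) → ∃ (s : ℕ) (q : (Fin s → R ⧸ J) →ₗ[R] T),
      Function.Surjective q := by
    intro T _ _ _ hT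
    have ht : Module.IsTorsionBySet R T J := fun t a => hT a a.2 t
    let _ := ht.module
    have : IsScalarTower R (R ⧸ J) T := ht.isScalarTower
    have : Module.Finite (R ⧸ J) T := Module.Finite.of_restrictScalars_finite R _ _
    obtain ⟨s, q, hq⟩ := Module.Finite.exists_fin' (R ⧸ J) T
    exact ⟨s, q.restrictScalars R, hq⟩
  have kerT : ∀ (s : ℕ) (S : Submodule R (Fin s → R ⧸ J)), ∀ a ∈ J, ∀ t : S, a • t = 0 := by
    intro s S a ha t
    ext j
    change a • (t.1 j) = 0
    obtain ⟨y, hy⟩ := Ideal.Quotient.mk_surjective (t.1 j)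
    rw [← hy]
    change Ideal.Quotient.mk J (a * y) = 0
    exact Ideal.Quotient.eq_zero_iff_mem.2 (J.mul_mem_right _ ha)
  induction i with
  | zero =>
    intro _ T _ _ _ hT
    obtain ⟨s, q, hq⟩ := key T hT
    let exac := LinearMap.shortExact_shortComplexKer hq
    refine subsingleton_of_forall_eq 0 fun e => ?_
    have := ext_pi_vanish (R ⧸ J) X 0 s (h 0 (by lia))
    have : Epi (ModuleCat.ofHom q) := exac.epi_g
    exact Abelian.Ext.precomp_mk₀_injective_of_epi X (ModuleCat.ofHom q) (Subsingleton.elim _ _)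
  | succ i ih =>
    intro hi T _ _ _ hT
    obtain ⟨s, q, hq⟩ := key T hT
    let exac := LinearMap.shortExact_shortComplexKer hq
    refine subsingleton_of_forall_eq 0 fun e => ?_
    have := ext_pi_vanish (R ⧸ J) X (i+1) s (h _ hi)
    have h2 := ih (by lia) (LinearMap.ker q) (kerT s _)
    obtain ⟨e', he'⟩ := Abelian.Ext.contravariant_sequence_exact₃ exac X
          e (Subsingleton.elim _ _) (add_comm 1 i)
    rw [← he', h2.elim e' 0, Abelian.Ext.comp_zero]

lemma ext_step {R : Type u} [CommRing R] [IsNoetherianRing R] (J : Ideal R)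
    (X : ModuleCat.{u} R) [Module.Finite R X] (x : R) (hx : x ∈ J)
    (T : Type u) [AddCommGroup T] [Module R T] [Module.Finite R T] (i : ℕ)
    (h1 : ∀ S : Submodule R T, (∀ t ∈ S, x • t = 0) → ∃ a ∈ J,
      ∀ e : Abelian.Ext (ModuleCat.of R S) X i, (1 - a) • e = 0)
    (h2 : ∀ S : Submodule R T, (∀ t, x • t ∈ S) → ∃ a ∈ J,
      ∀ e : Abelian.Ext (ModuleCat.of R (T ⧸ S)) X (i+1), (1 - a) • e = 0) :
    ∃ a ∈ J, ∀ e : Abelian.Ext (ModuleCat.of R T) X i, (1 - a) • e = 0 := by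
  let m : T →ₗ[R] T := LinearMap.lsmul R T x
  obtain ⟨a, ha, ha'⟩ := h1 (LinearMap.ker m) (fun t ht => ht)
  obtain ⟨b, hb, hb'⟩ := h2 (LinearMap.range m) (fun t => ⟨t, rfl⟩)
  let p := m.rangeRestrict
  let ι := (LinearMap.range m).subtype
  have hp : (ModuleCat.shortComplexOfCompEqZero (LinearMap.ker m).subtype p
    (by ext t; exact t.2)).ShortExact :=
    { exact := (ShortComplex.ShortExact.moduleCat_exact_iff_function_exact _).mpr
        fun t ↦ by
          change p t = 0 ↔ _
          simp [p, Subtype.ext_iff]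
      mono_f := (ModuleCat.mono_iff_injective _).mpr (LinearMap.ker m).injective_subtype
      epi_g := (ModuleCat.epi_iff_surjective _).mpr m.surjective_rangeRestrict }
  have hq : (ModuleCat.shortComplexOfCompEqZero ι (LinearMap.range m).mkQ
    (by ext t; simp [ι])).ShortExact :=
    { exact := (ShortComplex.ShortExact.moduleCat_exact_iff_function_exact _).mpr
        fun t ↦ by
          change (LinearMap.range m).mkQ t = 0 ↔ _
          simp [ι]
      mono_f := (ModuleCat.mono_iff_injective _).mpr (LinearMap.range m).injective_subtype
      epi_g := (ModuleCat.epi_iff_surjective _).mpr (LinearMap.range m).mkQ_surjective }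
  have key : ∀ e : Abelian.Ext (ModuleCat.of R T) X i, ∃ e', (1 - b) • (1 - a) • e = x • e' := by
    intro e
    obtain ⟨e', he'⟩ := Abelian.Ext.contravariant_sequence_exact₂ hp X ((1 - a) • e) (by
      rw [Abelian.Ext.comp_smul]; exact ha' _)
    obtain ⟨e'', he''⟩ := Abelian.Ext.contravariant_sequence_exact₁ hq X ((1 - b) • e')
      (add_comm 1 i) (by
      rw [Abelian.Ext.comp_smul]; exact hb' _)
    refine ⟨e'', ?_⟩
    rw [← he', ← Abelian.Ext.comp_smul, ← he'']
    have : ModuleCat.ofHom p ≫ ModuleCat.ofHom ι = x • 𝟙 (ModuleCat.of R T) := by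
      ext t; rfl
    rw [Abelian.Ext.mk₀_comp_mk₀_assoc]
    change (Abelian.Ext.mk₀ (ModuleCat.ofHom p ≫ ModuleCat.ofHom ι)).comp e'' _ = _
    rw [this, Abelian.Ext.mk₀_smul, Abelian.Ext.smul_comp, Abelian.Ext.mk₀_id_comp]
  obtain ⟨r, hr, hr'⟩ := Submodule.exists_sub_one_mem_and_smul_eq_zero_of_fg_of_le_smul J
    (⊤ : Submodule R (Abelian.Ext (ModuleCat.of R T) X i)) Module.Finite.fg_top (by
      intro e _
      obtain ⟨e', he'⟩ := key e
      have : e = x • e' + (a • e + b • e - (b * a) • e) := by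
        rw [← he']; module
      rw [this]
      have hh : ∀ c ∈ J, ∀ f : Abelian.Ext (ModuleCat.of R T) X i, c • f ∈ J • (⊤ : Submodule R (Abelian.Ext (ModuleCat.of R T) X i)) :=
        fun c hc f => Submodule.smul_mem_smul hc trivial
      exact add_mem (hh _ hx _) (sub_mem (add_mem (hh _ ha _) (hh _ hb _))
        (hh _ (J.mul_mem_left _ ha) _)))
  refine ⟨1 - r, by simpa using neg_mem hr, fun e => ?_⟩
  rw [sub_sub_cancel]
  exact hr' e trivial

lemma kill_of_ext_vanish {R : Type u} [CommRing R] [IsNoetherianRing R] (J : Ideal R) :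
    ∃ d : ℕ, ∀ (X : Type u) [AddCommGroup X] [Module R X] [Module.Finite R X],
    (∀ i ≤ d, Subsingleton (Abelian.Ext (ModuleCat.of R (R ⧸ J)) (ModuleCat.of R X) i)) →
    ∃ a ∈ J, ∀ x : X, (1 - a) • x = 0 := by
  obtain ⟨d, g, hg⟩ := Submodule.fg_iff_exists_fin_generating_family.1 (IsNoetherian.noetherian J)
  refine ⟨d, fun X _ _ _ hX => ?_⟩
  have S : ∀ k ≤ d, ∀ (T : Type u) [AddCommGroup T] [Module R T] [Module.Finite R T],
      (∀ j : Fin d, j < d - k → ∀ t : T, g j • t = 0) → ∀ i ≤ d - k,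
      ∃ a ∈ J, ∀ e : Abelian.Ext (ModuleCat.of R T) (ModuleCat.of R X) i, (1 - a) • e = 0 := by
    intro k
    induction k with
    | zero =>
      intro _ T _ _ _ hT i hi
      have := ext_vanish_of_torsion J (ModuleCat.of R X) d hX i (by lia) T (by
        intro a ha t
        rw [← hg] at ha
        induction ha using Submodule.span_induction with
        | mem y hy => obtain ⟨j, rfl⟩ := hy; exact hT j (by simp) t
        | zero => simp
        | add y z _ _ h1 h2 => rw [add_smul, h1, h2, add_zero]
        | smul c y _ h1 => rw [smul_assoc, h1, smul_zero])
      exact ⟨0, zero_mem _, fun e => Subsingleton.elim _ _⟩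
    | succ k ih =>
      intro hk T _ _ _ hT i hi
      have ih := ih (by lia)
      have hm : d - (k+1) < d := by lia
      have hx : g ⟨d - (k+1), hm⟩ ∈ J := by rw [← hg]; exact Submodule.subset_span ⟨_, rfl⟩
      refine ext_step J (ModuleCat.of R X) _ hx T i ?_ ?_
      · intro S hS
        refine ih S (fun j hj t => ?_) i (by lia)
        rcases (show j.1 < d - (k+1) ∨ j.1 = d - (k+1) by lia) with h | h
        · exact Subtype.ext (hT j h t)
        · have : j = ⟨d - (k+1), hm⟩ := Fin.ext h
          rw [this]
          exact Subtype.ext (hS t t.2)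
      · intro S hS
        refine ih (T ⧸ S) (fun j hj t => ?_) (i+1) (by lia)
        obtain ⟨t, rfl⟩ := S.mkQ_surjective t
        rw [← map_smul]
        rcases (show j.1 < d - (k+1) ∨ j.1 = d - (k+1) by lia) with h | h
        · rw [hT j h t, map_zero]
        · have : j = ⟨d - (k+1), hm⟩ := Fin.ext h
          rw [this]
          exact (Submodule.Quotient.mk_eq_zero S).2 (hS t)
  obtain ⟨a, ha, h⟩ := S d le_rfl R (fun j hj => by lia) 0 (by lia)
  refine ⟨a, ha, fun x => ?_⟩
  have := h (Abelian.Ext.mk₀ (ModuleCat.ofHom (LinearMap.toSpanSingleton R X x)))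
  rw [← Abelian.Ext.mk₀_smul, Abelian.Ext.mk₀_eq_zero_iff] at this
  have h3 := congrArg (fun f => f.hom (1 : R)) this
  simpa using h3

end ExtPart

section ARPart

variable {R : Type u} [CommRing R] {r : ℕ} (I : Fin r → Ideal R)

lemma prodPow_add (m n : Fin r → ℕ) : prodPow I (m + n) = prodPow I m * prodPow I n := by
  simp [prodPow, pow_add, Finset.prod_mul_distrib]

lemma prodPow_zero : prodPow I 0 = 1 := by simp [prodPow]

/-- The multi-Rees algebra. -/
def multiRees : Subalgebra R (MvPolynomial (Fin r) R) where
  carrier := {p | ∀ n : Fin r →₀ ℕ, p.coeff n ∈ prodPow I n}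
  mul_mem' := by
    intro p q hp hq n
    rw [MvPolynomial.coeff_mul]
    refine sum_mem fun x hx => ?_
    rw [← Finset.HasAntidiagonal.mem_antidiagonal.1 hx, Finsupp.coe_add, prodPow_add]
    exact Ideal.mul_mem_mul (hp _) (hq _)
  add_mem' := by
    intro p q hp hq n
    rw [MvPolynomial.coeff_add]
    exact add_mem (hp n) (hq n)
  algebraMap_mem' := by
    intro a n
    rw [MvPolynomial.algebraMap_eq, MvPolynomial.coeff_C]
    split_ifs with h
    · subst h
      rw [Finsupp.coe_zero, prodPow_zero]; simp
    · simp

lemma mem_multiRees (p : MvPolynomial (Fin r) R) :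
    p ∈ multiRees I ↔ ∀ n : Fin r →₀ ℕ, p.coeff n ∈ prodPow I n := Iff.rfl

lemma monomial_mem_multiRees (n : Fin r →₀ ℕ) (a : R) (ha : a ∈ prodPow I n) :
    MvPolynomial.monomial n a ∈ multiRees I := by
  rw [mem_multiRees]
  intro m
  rw [MvPolynomial.coeff_monomial]
  split_ifs with h
  · rwa [← h]
  · simp

lemma multiRees_eq {ι : Type} (σ : ι → Fin r) (a : ι → R)
    (h : ∀ i, I i = Ideal.span {x | ∃ j, σ j = i ∧ a j = x}) :
    multiRees I = Algebra.adjoin R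
      (Set.range fun j => MvPolynomial.monomial (Finsupp.single (σ j) 1) (a j)) := by
  set A := Algebra.adjoin R
      (Set.range fun j => MvPolynomial.monomial (Finsupp.single (σ j) 1) (a j)) with hA
  apply le_antisymm
  · have h1 : ∀ i, ∀ x ∈ I i, MvPolynomial.monomial (Finsupp.single i 1) x ∈ A := by
      intro i x hx
      rw [h] at hx
      induction hx using Submodule.span_induction with
      | mem y hy => obtain ⟨j, rfl, rfl⟩ := hy; exact Algebra.subset_adjoin ⟨j, rfl⟩
      | zero => simp
      | add y z _ _ h1 h2 => rw [map_add]; exact add_mem h1 h2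
      | smul c y _ h1 => rw [map_smul]; exact A.smul_mem h1 c
    -- general product lemma
    have mulmem : ∀ (m n : Fin r →₀ ℕ) (K L : Ideal R),
        (∀ x ∈ K, MvPolynomial.monomial m x ∈ A) → (∀ x ∈ L, MvPolynomial.monomial n x ∈ A) →
        ∀ x ∈ K * L, MvPolynomial.monomial (m + n) x ∈ A := by
      intro m n K L hK hL x hx
      induction hx using Submodule.mul_induction_on' with
      | mem_mul_mem y hy z hz =>
        rw [← MvPolynomial.monomial_mul]
        exact mul_mem (hK y hy) (hL z hz)
      | add y _ z _ h1 h2 => rw [map_add]; exact add_mem h1 h2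
    have one : ∀ x : R, MvPolynomial.monomial (0 : Fin r →₀ ℕ) x ∈ A := fun x => A.algebraMap_mem x
    have h2 : ∀ i, ∀ k : ℕ, ∀ x ∈ I i ^ k, MvPolynomial.monomial (Finsupp.single i k) x ∈ A := by
      intro i k
      induction k with
      | zero => intro x _; rw [Finsupp.single_zero]; exact one x
      | succ k ih =>
        rw [Finsupp.single_add, pow_succ]
        exact mulmem _ _ _ _ ih (h1 i)
    have h3 : ∀ (n : Fin r →₀ ℕ) (s : Finset (Fin r)),
        ∀ x ∈ ∏ i ∈ s, I i ^ n i, MvPolynomial.monomial (∑ i ∈ s, Finsupp.single i (n i)) x ∈ A := by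
      intro n s
      induction s using Finset.induction_on with
      | empty => intro x _; exact one x
      | insert i s hi ih =>
        rw [Finset.prod_insert hi, Finset.sum_insert hi]
        exact mulmem _ _ _ _ (h2 i _) ih
    intro p hp
    rw [MvPolynomial.as_sum p]
    refine sum_mem fun n _ => ?_
    have := h3 n Finset.univ _ (hp n)
    rwa [Finsupp.univ_sum_single] at this
  · rw [hA, Algebra.adjoin_le_iff]
    rintro _ ⟨j, rfl⟩
    refine monomial_mem_multiRees I _ _ ?_
    have : prodPow I (Finsupp.single (σ j) 1) = I (σ j) := by
      rw [prodPow, Finset.prod_eq_single (σ j)]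
      · simp
      · intro b _ hb; rw [Finsupp.single_eq_of_ne (by exact hb), pow_zero]
      · simp
    rw [this, h]
    exact Ideal.subset_span ⟨j, rfl, rfl⟩

lemma multiRees_noeth [IsNoetherianRing R] : IsNoetherianRing (multiRees I) := by
  have : ∀ i, ∃ (d : ℕ) (g : Fin d → R), Ideal.span (Set.range g) = I i := fun i =>
    Submodule.fg_iff_exists_fin_generating_family.1 (IsNoetherian.noetherian (I i))
  choose d g hg using this
  have := multiRees_eq I (ι := Σ i, Fin (d i)) (fun j => j.1) (fun j => g j.1 j.2) (by
    intro i
    rw [← hg]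
    congr 1
    ext x
    constructor
    · rintro ⟨k, rfl⟩; exact ⟨⟨i, k⟩, rfl, rfl⟩
    · rintro ⟨⟨i, k⟩, rfl, rfl⟩; exact ⟨k, rfl⟩)
  apply isNoetherianRing_of_fg
  rw [this]
  exact Subalgebra.fg_def.2 ⟨_, Set.finite_range _, rfl⟩

/-- Multi-ideal Artin-Rees, free case. -/
lemma AR_free [IsNoetherianRing R] (g : ℕ) (Z : Submodule R (Fin g → R)) :
    ∃ k : Fin r → ℕ, ∀ n, k ≤ n → ∀ z ∈ Z, (∀ l, z l ∈ prodPow I n) →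
      z ∈ prodPow I (n - k) • (prodPow I k • (⊤ : Submodule R (Fin g → R)) ⊓ Z) := by
  have := multiRees_noeth I
  let ZZ : Submodule (multiRees I) (Fin g → multiRees I) :=
    { carrier := {p | ∀ n : Fin r →₀ ℕ, (fun l => (p l).1.coeff n) ∈ Z}
      add_mem' := by
        intro p q hp hq n
        exact add_mem (hp n) (hq n)
      zero_mem' := by
        intro n
        exact zero_mem Z
      smul_mem' := by
        intro c p hp n
        have : (fun l => ((c • p) l).1.coeff n) =
          ∑ x ∈ Finset.HasAntidiagonal.antidiagonal n, c.1.coeff x.1 • (fun l => (p l).1.coeff x.2) := by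
          ext l
          rw [Finset.sum_apply]
          exact MvPolynomial.coeff_mul _ _ _
        rw [this]
        exact sum_mem fun x _ => Z.smul_mem _ (hp _) }
  obtain ⟨s, p, hp⟩ := Submodule.fg_iff_exists_fin_generating_family.1 (IsNoetherian.noetherian ZZ)
  -- bound on the degrees
  let D : Finset (Fin r →₀ ℕ) :=
    Finset.univ.biUnion fun j : Fin s => Finset.univ.biUnion fun l => (p j l).1.support
  let k : Fin r →₀ ℕ := D.sup id
  have hk : ∀ j l m, (p j l).1.coeff m ≠ 0 → m ≤ k := by
    intro j l m hm
    refine Finset.le_sup (f := id) (s := D) ?_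
    simp only [D, Finset.mem_biUnion, Finset.mem_univ, true_and]
    exact ⟨j, l, MvPolynomial.mem_support_iff.2 hm⟩
  have top_mem : ∀ (n : Fin r → ℕ) (z : Fin g → R), (∀ l, z l ∈ prodPow I n) →
      z ∈ prodPow I n • (⊤ : Submodule R (Fin g → R)) := by
    intro n z hz
    rw [pi_eq_sum_univ' z]
    exact sum_mem fun l _ => Submodule.smul_mem_smul (hz l) trivial
  refine ⟨k, fun n hn z hzZ hz => ?_⟩
  obtain ⟨n, rfl⟩ := Finsupp.equivFunOnFinite.surjective n
  change ∀ l, z l ∈ prodPow I n at hz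
  change (k : Fin r → ℕ) ≤ (n : Fin r → ℕ) at hn
  change z ∈ prodPow I ((n : Fin r → ℕ) - k) • _
  let q : Fin g → multiRees I := fun l => ⟨MvPolynomial.monomial n (z l),
    monomial_mem_multiRees I n _ (hz l)⟩
  have hq : q ∈ ZZ := by
    intro m
    by_cases h : n = m
    · subst h
      have : (fun l => (q l).1.coeff n) = z := by
        ext l; simp [q]
      rwa [this]
    · have : (fun l => (q l).1.coeff m) = 0 := by
        ext l; simp [q, MvPolynomial.coeff_monomial, h]
      rw [this]; exact zero_mem _
  have hpZ : ∀ j, p j ∈ ZZ := fun j => by rw [← hp]; exact Submodule.subset_span ⟨j, rfl⟩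
  rw [← hp, Submodule.mem_span_range_iff_exists_fun] at hq
  obtain ⟨c, hc⟩ := hq
  have hz2 : z = ∑ j, ∑ x ∈ Finset.HasAntidiagonal.antidiagonal n,
      (c j).1.coeff x.1 • (fun l => (p j l).1.coeff x.2) := by
    ext l
    have h1 : (q l).1.coeff n = z l := by simp [q]
    rw [← h1, ← hc]
    simp only [Finset.sum_apply, Pi.smul_apply, AddSubmonoidClass.coe_finsetSum,
      MvPolynomial.coeff_sum]
    refine Finset.sum_congr rfl fun j _ => ?_
    exact MvPolynomial.coeff_mul _ _ _
  rw [hz2]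
  refine sum_mem fun j _ => sum_mem fun x hx => ?_
  have hx := Finset.HasAntidiagonal.mem_antidiagonal.1 hx
  by_cases h0 : (fun l => (p j l).1.coeff x.2) = 0
  · rw [h0, smul_zero]; exact zero_mem _
  obtain ⟨l, hl⟩ := Function.ne_iff.1 h0
  have hxk : x.2 ≤ k := hk j l x.2 hl
  have hx1 : (x.1 : Fin r → ℕ) = ((n : Fin r → ℕ) - k) + ((k : Fin r → ℕ) - x.2) := by
    ext i
    have h1 : x.1 i + x.2 i = n i := by rw [← hx]; rfl
    have h2 := hxk i
    have h3 := hn i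
    simp only [Pi.add_apply, Pi.sub_apply]
    lia
  have hx2 : (k : Fin r → ℕ) = ((k : Fin r → ℕ) - x.2) + x.2 := by
    ext i
    have h2 := hxk i
    simp only [Pi.add_apply, Pi.sub_apply]
    lia
  have hmem := (c j).2 x.1
  rw [hx1, prodPow_add] at hmem
  have h4 : (c j).1.coeff x.1 • (fun l => (p j l).1.coeff x.2) ∈
      (prodPow I ((n : Fin r → ℕ) - k) * prodPow I ((k : Fin r → ℕ) - x.2)) •
      (prodPow I x.2 • (⊤ : Submodule R (Fin g → R)) ⊓ Z) :=
    Submodule.smul_mem_smul hmem ⟨top_mem _ _ fun l => (p j l).2 x.2, hpZ j x.2⟩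
  rw [mul_smul] at h4
  refine Submodule.smul_mono le_rfl ?_ h4
  refine le_inf ?_ ?_
  · conv_rhs => rw [hx2, prodPow_add, mul_smul]
    exact Submodule.smul_mono le_rfl inf_le_left
  · exact (Submodule.smul_mono le_rfl inf_le_right).trans Submodule.smul_le_right

/-- Multi-ideal Artin-Rees. -/
lemma AR_general [IsNoetherianRing R] {E : Type*} [AddCommGroup E] [Module R E]
    [Module.Finite R E] (W Z : Submodule R E) :
    ∃ k : Fin r → ℕ, ∀ n, k ≤ n →
      prodPow I n • W ⊓ Z ≤ prodPow I (n - k) • (prodPow I k • W ⊓ Z) := by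
  obtain ⟨g, q, hq⟩ := Module.Finite.exists_fin' R W
  let q' := W.subtype ∘ₗ q
  have hq' : Submodule.map q' ⊤ = W := by
    rw [Submodule.map_top, LinearMap.range_comp, LinearMap.range_eq_top.2 hq]; simp
  obtain ⟨k, hk⟩ := AR_free I g (Z.comap q')
  refine ⟨k, fun n hn => ?_⟩
  rintro x ⟨hx1, hx2⟩
  rw [← hq', ← Submodule.map_smul''] at hx1
  obtain ⟨z, hz, rfl⟩ := hx1
  have hz' : ∀ l, z l ∈ prodPow I n := by
    intro l
    have : prodPow I n • (⊤ : Submodule R (Fin g → R)) ≤ Submodule.comap (LinearMap.proj l : (Fin g → R) →ₗ[R] R) (prodPow I n) := by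
      rw [Submodule.smul_le]
      intro a ha y _
      exact Ideal.mul_mem_right _ _ ha
    exact this hz
  have := hk n hn z hx2 hz'
  have h2 := Submodule.mem_map_of_mem (f := q') this
  rw [Submodule.map_smul''] at h2
  refine Submodule.smul_mono le_rfl ?_ h2
  refine (Submodule.map_inf_le _).trans ?_
  rw [Submodule.map_smul'', hq']
  exact inf_le_inf_left _ (Submodule.map_comap_le _ _)


/-- Families of submodules which are eventually of the form `U + I^(n-k) W`. -/
def IsAR {E : Type*} [AddCommGroup E] [Module R E] (D : (Fin r → ℕ) → Submodule R E) : Prop :=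
  ∃ (U W : Submodule R E) (k : Fin r → ℕ), ∀ n, k ≤ n → D n = U ⊔ prodPow I (n - k) • W

section

variable {I}
variable {E : Type*} [AddCommGroup E] [Module R E] {E' : Type*} [AddCommGroup E'] [Module R E']

lemma IsAR.enlarge {D : (Fin r → ℕ) → Submodule R E} (h : IsAR I D) :
    ∃ (U : Submodule R E) (k : Fin r → ℕ), ∀ k', k ≤ k' → ∃ W : Submodule R E,
      ∀ n, k' ≤ n → D n = U ⊔ prodPow I (n - k') • W := by
  obtain ⟨U, W, k, h⟩ := h
  refine ⟨U, k, fun k' hk' => ⟨prodPow I (k' - k) • W, fun n hn => ?_⟩⟩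
  rw [h n (hk'.trans hn), ← mul_smul, ← prodPow_add]
  congr 3
  ext i
  have h1 := hk' i
  have h2 := hn i
  simp only [Pi.add_apply, Pi.sub_apply]
  lia

lemma IsAR.common {D : (Fin r → ℕ) → Submodule R E} (h : IsAR I D)
    {D' : (Fin r → ℕ) → Submodule R E'} (h' : IsAR I D') :
    ∃ (k : Fin r → ℕ) (U W : Submodule R E) (U' W' : Submodule R E'), ∀ n, k ≤ n →
      D n = U ⊔ prodPow I (n - k) • W ∧ D' n = U' ⊔ prodPow I (n - k) • W' := by
  obtain ⟨U, k, h⟩ := h.enlarge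
  obtain ⟨U', k', h'⟩ := h'.enlarge
  obtain ⟨W, h⟩ := h (k ⊔ k') le_sup_left
  obtain ⟨W', h'⟩ := h' (k ⊔ k') le_sup_right
  exact ⟨k ⊔ k', U, W, U', W', fun n hn => ⟨h n hn, h' n hn⟩⟩

lemma IsAR.const (U : Submodule R E) : IsAR I (fun _ => U) :=
  ⟨U, ⊥, 0, fun n _ => by simp⟩

lemma IsAR.sup {D D' : (Fin r → ℕ) → Submodule R E} (h : IsAR I D) (h' : IsAR I D') :
    IsAR I (fun n => D n ⊔ D' n) := by
  obtain ⟨k, U, W, U', W', h⟩ := h.common h'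
  refine ⟨U ⊔ U', W ⊔ W', k, fun n hn => ?_⟩
  beta_reduce
  rw [(h n hn).1, (h n hn).2, Submodule.smul_sup]
  exact sup_sup_sup_comm _ _ _ _

lemma IsAR.map {D : (Fin r → ℕ) → Submodule R E} (h : IsAR I D) (g : E →ₗ[R] E') :
    IsAR I (fun n => (D n).map g) := by
  obtain ⟨U, W, k, h⟩ := h
  refine ⟨U.map g, W.map g, k, fun n hn => ?_⟩
  beta_reduce
  rw [h n hn, Submodule.map_sup, Submodule.map_smul'']

lemma IsAR.comap [IsNoetherianRing R] [Module.Finite R E']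
    {D : (Fin r → ℕ) → Submodule R E'} (h : IsAR I D) (g : E →ₗ[R] E') :
    IsAR I (fun n => (D n).comap g) := by
  obtain ⟨U, W, k, h⟩ := h
  let g' := U.mkQ ∘ₗ g
  obtain ⟨k', hk'⟩ := AR_general I (W.map U.mkQ) (LinearMap.range g')
  refine ⟨LinearMap.ker g', (prodPow I k' • W.map U.mkQ).comap g', k + k', fun n hn => ?_⟩
  have hn1 : k ≤ n := fun i => by have := hn i; simp only [Pi.add_apply] at this; lia
  have hn2 : k' ≤ n - k := fun i => by
    have := hn i; simp only [Pi.add_apply, Pi.sub_apply] at this ⊢; lia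
  have e1 : n - (k + k') = n - k - k' := by
    ext i; simp only [Pi.add_apply, Pi.sub_apply]; lia
  beta_reduce
  rw [h n hn1, ← Submodule.comap_map_mkQ, Submodule.map_smul'', ← Submodule.comap_comp, e1]
  have hn3 : n - k = (n - k - k') + k' := by
    ext i; have := hn2 i; simp only [Pi.add_apply, Pi.sub_apply] at this ⊢; lia
  apply le_antisymm
  · intro x hx
    have h1 := hk' (n - k) hn2 ⟨hx, ⟨x, rfl⟩⟩
    rw [inf_comm, ← Submodule.map_comap_eq, ← Submodule.map_smul''] at h1
    obtain ⟨y, hy, hxy⟩ := h1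
    rw [← sub_add_cancel x y]
    refine Submodule.add_mem_sup ?_ hy
    rw [LinearMap.mem_ker, map_sub, hxy]
    exact sub_self _
  · refine sup_le ?_ ?_
    · intro x hx
      rw [Submodule.mem_comap]
      rw [LinearMap.mem_ker] at hx
      change g' x ∈ _
      rw [hx]; exact zero_mem _
    · rw [← Submodule.map_le_iff_le_comap]
      change Submodule.map g' _ ≤ _
      conv_rhs => rw [hn3]
      rw [Submodule.map_smul'', prodPow_add]
      refine le_trans ?_ (mul_smul (prodPow I (n - k - k')) (prodPow I k') (W.map U.mkQ)).ge
      exact Submodule.smul_mono le_rfl (Submodule.map_comap_le _ _)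

lemma IsAR.inf [IsNoetherianRing R] [Module.Finite R E] {D D' : (Fin r → ℕ) → Submodule R E}
    (h : IsAR I D) (h' : IsAR I D') : IsAR I (fun n => D n ⊓ D' n) := by
  have := ((h.map (LinearMap.inl R E E)).sup (h'.map (LinearMap.inr R E E))).comap
    (LinearMap.prod LinearMap.id LinearMap.id)
  convert this using 2 with n
  ext x
  simp only [Submodule.mem_inf, Submodule.mem_comap, Submodule.mem_sup, Submodule.mem_map]
  constructor
  · rintro ⟨h1, h2⟩
    exact ⟨_, ⟨x, h1, rfl⟩, _, ⟨x, h2, rfl⟩, by simp⟩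
  · rintro ⟨_, ⟨y, hy, rfl⟩, _, ⟨z, hz, rfl⟩, h⟩
    simp at h
    obtain ⟨rfl, rfl⟩ := h
    exact ⟨hy, hz⟩

lemma IsAR.iInf [IsNoetherianRing R] [Module.Finite R E] {ι : Type*} (s : Finset ι)
    {D : ι → (Fin r → ℕ) → Submodule R E}
    (h : ∀ i, IsAR I (D i)) : IsAR I (fun n => s.inf fun i => D i n) := by
  classical
  induction s using Finset.induction_on with
  | empty => exact IsAR.const ⊤
  | insert i s _ ih =>
    simp only [Finset.inf_insert]
    exact (h i).inf ih

/-- Stability of the inclusion between two such families. -/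
lemma IsAR.stable {D D' : (Fin r → ℕ) → Submodule R E} (h : IsAR I D) (h' : IsAR I D') :
    ∃ c, (∀ n, c ≤ n → D n ≤ D' n) ∨ (∀ n, c ≤ n → ¬ D n ≤ D' n) := by
  obtain ⟨k, U, W, U', W', h⟩ := h.common h'
  have key : ∀ n, k ≤ n → (D n ≤ D' n ↔ U ≤ U' ⊔ prodPow I (n - k) • W' ∧
      prodPow I (n - k) • W ≤ U' ⊔ prodPow I (n - k) • W') := by
    intro n hn
    rw [(h n hn).1, (h n hn).2, sup_le_iff]
  have ex : ∀ m0 n : Fin r → ℕ, k + m0 ≤ n → k ≤ n ∧ ∃ t, n - k = t + m0 := by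
    intro m0 n hn
    refine ⟨fun i => ?_, n - (k + m0), ?_⟩
    · have := hn i; simp only [Pi.add_apply] at this; lia
    · ext i
      have := hn i
      simp only [Pi.add_apply, Pi.sub_apply] at this ⊢; lia
  by_cases h1 : ∃ m0, ¬ U ≤ U' ⊔ prodPow I m0 • W'
  · obtain ⟨m0, h1⟩ := h1
    refine ⟨k + m0, Or.inr fun n hn hle => h1 ?_⟩
    obtain ⟨hk, t, ht⟩ := ex m0 n hn
    refine ((key n hk).1 hle).1.trans (sup_le_sup_left ?_ _)
    rw [ht, prodPow_add, mul_smul]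
    exact Submodule.smul_le_right
  · push Not at h1
    by_cases h2 : ∃ m0, prodPow I m0 • W ≤ U' ⊔ prodPow I m0 • W'
    · obtain ⟨m0, h2⟩ := h2
      refine ⟨k + m0, Or.inl fun n hn => ?_⟩
      obtain ⟨hk, t, ht⟩ := ex m0 n hn
      refine (key n hk).2 ⟨h1 _, ?_⟩
      rw [ht, prodPow_add, mul_smul, mul_smul]
      refine (Submodule.smul_mono le_rfl h2).trans ?_
      rw [Submodule.smul_sup]
      exact sup_le_sup_right Submodule.smul_le_right _
    · push Not at h2
      exact ⟨k, Or.inr fun n hn hle => h2 _ ((key n hn).1 hle).2⟩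

/-- The linear maps `φ` with `φ (A v) ∈ D` for all `v`. -/
def homInto {a p : ℕ} (A : (Fin a → R) →ₗ[R] (Fin p → R)) (D : Submodule R E) :
    Submodule R ((Fin p → R) →ₗ[R] E) where
  carrier := {φ | ∀ v, φ (A v) ∈ D}
  add_mem' := fun h1 h2 v => add_mem (h1 v) (h2 v)
  zero_mem' := fun _ => zero_mem _
  smul_mem' := fun c _ h v => D.smul_mem c (h v)

lemma mem_homInto {a p : ℕ} (A : (Fin a → R) →ₗ[R] (Fin p → R)) (D : Submodule R E)
    (φ : (Fin p → R) →ₗ[R] E) : φ ∈ homInto A D ↔ ∀ v, φ (A v) ∈ D := Iff.rfl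

lemma forall_mem_of_basis {a : ℕ} (φ : (Fin a → R) →ₗ[R] E) (D : Submodule R E)
    (h : ∀ i, φ (Pi.single i 1) ∈ D) (v : Fin a → R) : φ v ∈ D := by
  rw [pi_eq_sum_univ' v, map_sum]
  refine sum_mem fun i _ => ?_
  rw [map_smul]
  refine D.smul_mem _ ?_
  convert h i using 2

lemma IsAR.homInto [IsNoetherianRing R] [Module.Finite R E] {a p : ℕ}
    (A : (Fin a → R) →ₗ[R] (Fin p → R))
    {D : (Fin r → ℕ) → Submodule R E} (h : IsAR I D) : IsAR I (fun n => homInto A (D n)) := by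
  have := IsAR.iInf (I := I) (Finset.univ : Finset (Fin a)) (D := fun i n => (D n).comap
    (LinearMap.applyₗ (R := R) (M := Fin p → R) (M₂ := E) (A (Pi.single i 1)))) fun i => h.comap _
  convert this using 2 with n
  ext φ
  rw [mem_homInto, Submodule.mem_finsetInf]
  constructor
  · intro h i _; exact h _
  · intro h v
    exact forall_mem_of_basis (φ ∘ₗ A) (D n) (fun i => h i (Finset.mem_univ _)) v

end

/-- A linear relation `G` presenting `X` as `U / V`. -/
structure Presents {E X : Type u} [AddCommGroup E] [Module R E] [AddCommGroup X] [Module R X]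
    (U V : Submodule R E) (G : Submodule R (E × X)) : Prop where
  ex : ∀ x ∈ U, ∃ y, (x, y) ∈ G
  mem : ∀ x y, (x, y) ∈ G → x ∈ U
  surj : ∀ y, ∃ x, (x, y) ∈ G
  ker : ∀ x y, (x, y) ∈ G → (x ∈ V ↔ y = 0)

namespace Presents

variable {E X : Type u} [AddCommGroup E] [Module R E] [AddCommGroup X] [Module R X]
    {U V : Submodule R E} {G : Submodule R (E × X)}

lemma subsingleton_iff (h : Presents U V G) : Subsingleton X ↔ U ≤ V := by
  constructor
  · intro _ x hx
    obtain ⟨y, hy⟩ := h.ex x hx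
    exact (h.ker x y hy).2 (Subsingleton.elim _ _)
  · intro hle
    refine subsingleton_of_forall_eq 0 fun y => ?_
    obtain ⟨x, hx⟩ := h.surj y
    exact (h.ker x y hx).1 (hle (h.mem x y hx))

lemma lift1 (h : Presents U V G) {P : Type u} [AddCommGroup P] [Module R P] {a p : ℕ}
    (π : (Fin p → R) →ₗ[R] P) (hπ : Function.Surjective π) (A : (Fin a → R) →ₗ[R] (Fin p → R))
    (hA : LinearMap.range A = LinearMap.ker π) (φ : (Fin p → R) →ₗ[R] E)
    (h1 : φ ∈ homInto LinearMap.id U) (h2 : φ ∈ homInto A V) :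
    ∃ t : P →ₗ[R] X, ∀ v, (φ v, t (π v)) ∈ G := by
  choose y hy using fun i : Fin p => h.ex _ (h1 (Pi.single i 1))
  let t' : (Fin p → R) →ₗ[R] X := (Pi.basisFun R (Fin p)).constr R y
  have ht' : ∀ v, (φ v, t' v) ∈ G := by
    refine forall_mem_of_basis (φ.prod t') G fun i => ?_
    have : t' (Pi.single i 1) = y i := by
      rw [← Pi.basisFun_apply, Module.Basis.constr_basis]
    change (φ _, t' _) ∈ G
    rw [this]
    exact hy i
  have hker : LinearMap.ker π ≤ LinearMap.ker t' := by
    rw [← hA]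
    rintro _ ⟨v, rfl⟩
    exact (h.ker _ _ (ht' (A v))).1 (h2 v)
  let e := π.quotKerEquivOfSurjective hπ
  refine ⟨(LinearMap.ker π).liftQ t' hker ∘ₗ e.symm.toLinearMap, fun v => ?_⟩
  have : e.symm (π v) = (LinearMap.ker π).mkQ v := by
    rw [LinearEquiv.symm_apply_eq]; rfl
  rw [LinearMap.comp_apply, LinearEquiv.coe_coe, this, Submodule.mkQ_apply, Submodule.liftQ_apply]
  exact ht' v

lemma lift2 (h : Presents U V G) {P : Type u} [AddCommGroup P] [Module R P] {p : ℕ}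
    (π : (Fin p → R) →ₗ[R] P) (t : P →ₗ[R] X) :
    ∃ φ : (Fin p → R) →ₗ[R] E, ∀ v, (φ v, t (π v)) ∈ G := by
  choose y hy using fun i : Fin p => h.surj (t (π (Pi.single i 1)))
  let φ : (Fin p → R) →ₗ[R] E := (Pi.basisFun R (Fin p)).constr R y
  refine ⟨φ, ?_⟩
  refine forall_mem_of_basis (φ.prod (t ∘ₗ π)) G fun i => ?_
  have : φ (Pi.single i 1) = y i := by
    rw [← Pi.basisFun_apply, Module.Basis.constr_basis]
  change (φ _, t (π _)) ∈ G
  rw [this]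
  exact hy i

lemma mem_conds (h : Presents U V G) {P : Type u} [AddCommGroup P] [Module R P] {a p : ℕ}
    (π : (Fin p → R) →ₗ[R] P) (A : (Fin a → R) →ₗ[R] (Fin p → R))
    (hA : LinearMap.range A = LinearMap.ker π) (φ : (Fin p → R) →ₗ[R] E)
    (t : P →ₗ[R] X) (ht : ∀ v, (φ v, t (π v)) ∈ G) :
    φ ∈ homInto LinearMap.id U ⊓ homInto A V := by
  refine ⟨fun v => h.mem _ _ (ht v), fun v => (h.ker _ _ (ht _)).2 ?_⟩
  have : A v ∈ LinearMap.ker π := by rw [← hA]; exact ⟨v, rfl⟩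
  rw [LinearMap.mem_ker] at this
  rw [this, map_zero]

/-- The induced relation on the coherent functor. -/
def rel {P Q : Type u} [AddCommGroup P] [Module R P] [AddCommGroup Q] [Module R Q]
    (g : P →ₗ[R] Q) {p : ℕ} (π : (Fin p → R) →ₗ[R] P) (G : Submodule R (E × X)) :
    Submodule R (((Fin p → R) →ₗ[R] E) × coherentApply g X) where
  carrier := {z | ∃ t : P →ₗ[R] X, Submodule.Quotient.mk t = z.2 ∧ ∀ v, (z.1 v, t (π v)) ∈ G}
  add_mem' := by
    rintro z z' ⟨t, h1, h2⟩ ⟨t', h1', h2'⟩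
    exact ⟨t + t', by rw [Submodule.Quotient.mk_add, h1, h1']; rfl,
      fun v => G.add_mem (h2 v) (h2' v)⟩
  zero_mem' := ⟨0, rfl, fun v => G.zero_mem⟩
  smul_mem' := by
    rintro c z ⟨t, h1, h2⟩
    exact ⟨c • t, by rw [Submodule.Quotient.mk_smul, h1]; rfl, fun v => G.smul_mem c (h2 v)⟩

lemma coherent (h : Presents U V G) {P Q : Type u} [AddCommGroup P] [Module R P]
    [AddCommGroup Q] [Module R Q] (g : P →ₗ[R] Q) {a p c q : ℕ}
    (π : (Fin p → R) →ₗ[R] P) (hπ : Function.Surjective π) (A : (Fin a → R) →ₗ[R] (Fin p → R))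
    (hA : LinearMap.range A = LinearMap.ker π)
    (ρ : (Fin q → R) →ₗ[R] Q) (hρ : Function.Surjective ρ) (C : (Fin c → R) →ₗ[R] (Fin q → R))
    (hC : LinearMap.range C = LinearMap.ker ρ)
    (B : (Fin p → R) →ₗ[R] (Fin q → R)) (hB : ∀ v, ρ (B v) = g (π v)) :
    Presents (homInto LinearMap.id U ⊓ homInto A V)
      ((homInto LinearMap.id U ⊓ homInto C V).map (LinearMap.lcomp R E B) ⊔
        homInto LinearMap.id V) (rel g π G) where
  ex := by
    rintro φ ⟨h1, h2⟩
    obtain ⟨t, ht⟩ := h.lift1 π hπ A hA φ h1 h2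
    exact ⟨Submodule.Quotient.mk t, t, rfl, ht⟩
  mem := by
    rintro φ y ⟨t, -, ht⟩
    exact h.mem_conds π A hA φ t ht
  surj := by
    intro y
    obtain ⟨t, rfl⟩ := Submodule.Quotient.mk_surjective _ y
    obtain ⟨φ, hφ⟩ := h.lift2 π t
    exact ⟨φ, t, rfl, hφ⟩
  ker := by
    rintro φ y ⟨t, hty, ht⟩
    change Submodule.Quotient.mk t = y at hty
    subst hty
    rw [Submodule.Quotient.mk_eq_zero]
    constructor
    · intro hφ
      obtain ⟨_, ⟨ψ, hψ, rfl⟩, φ', hφ', rfl⟩ := Submodule.mem_sup.1 hφ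
      obtain ⟨s, hs⟩ := h.lift1 ρ hρ C hC ψ hψ.1 hψ.2
      refine ⟨s, ?_⟩
      ext x
      obtain ⟨v, rfl⟩ := hπ x
      have h1 := G.sub_mem (ht v) (hs (B v))
      rw [hB] at h1
      have h2 := h.ker _ _ h1
      have h3 : ((LinearMap.lcomp R E B) ψ + φ') v - ψ (B v) ∈ V := by
        have : ((LinearMap.lcomp R E B) ψ + φ') v - ψ (B v) = φ' v := by
          simp
        rw [this]; exact hφ' v
      exact (sub_eq_zero.1 (h2.1 h3)).symm
    · rintro ⟨s, rfl⟩
      obtain ⟨ψ, hψ⟩ := h.lift2 ρ s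
      refine Submodule.mem_sup.2 ⟨_, ⟨ψ, h.mem_conds ρ C hC ψ s hψ, rfl⟩,
        φ - LinearMap.lcomp R E B ψ, fun v => ?_, by simp⟩
      have h1 := G.sub_mem (ht v) (hψ (B v))
      rw [hB] at h1
      exact (h.ker _ _ h1).2 (sub_self _)

end Presents

/-- Families presented as quotients of Artin-Rees families. -/
def Good (X : (Fin r → ℕ) → Type u) [∀ n, AddCommGroup (X n)] [∀ n, Module R (X n)] : Prop :=
  ∃ (E : Type u) (_ : AddCommGroup E) (_ : Module R E) (_ : Module.Finite R E)
    (U V : (Fin r → ℕ) → Submodule R E) (_ : IsAR I U) (_ : IsAR I V),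
    ∀ n, ∃ G : Submodule R (E × X n), Presents (U n) (V n) G

lemma exists_pres [IsNoetherianRing R] (P : Type u) [AddCommGroup P] [Module R P]
    [Module.Finite R P] : ∃ (a p : ℕ) (π : (Fin p → R) →ₗ[R] P)
      (A : (Fin a → R) →ₗ[R] (Fin p → R)),
      Function.Surjective π ∧ LinearMap.range A = LinearMap.ker π := by
  obtain ⟨p, π, hπ⟩ := Module.Finite.exists_fin' R P
  obtain ⟨a, A, hA⟩ := Module.Finite.exists_fin' R (LinearMap.ker π)
  refine ⟨a, p, π, (LinearMap.ker π).subtype ∘ₗ A, hπ, ?_⟩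
  rw [LinearMap.range_comp, LinearMap.range_eq_top.2 hA]; simp

lemma Good.coherent [IsNoetherianRing R] {X : (Fin r → ℕ) → Type u} [∀ n, AddCommGroup (X n)]
    [∀ n, Module R (X n)] (h : Good I X) {P Q : Type u} [AddCommGroup P] [Module R P]
    [Module.Finite R P] [AddCommGroup Q] [Module R Q] [Module.Finite R Q] (g : P →ₗ[R] Q) :
    Good I (fun n => coherentApply g (X n)) := by
  obtain ⟨E, _, _, _, U, V, hU, hV, h⟩ := h
  obtain ⟨a, p, π, A, hπ, hA⟩ := exists_pres (R := R) P
  obtain ⟨c, q, ρ, C, hρ, hC⟩ := exists_pres (R := R) Q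
  obtain ⟨B, hB⟩ := Module.projective_lifting_property ρ (g ∘ₗ π) hρ
  refine ⟨(Fin p → R) →ₗ[R] E, inferInstance, inferInstance, inferInstance, _, _,
    (hU.homInto LinearMap.id).inf (hV.homInto A),
    (((hU.homInto LinearMap.id).inf (hV.homInto C)).map (LinearMap.lcomp R E B)).sup
      (hV.homInto LinearMap.id), fun n => ?_⟩
  obtain ⟨G, hG⟩ := h n
  exact ⟨_, hG.coherent g π hπ A hA ρ hρ C hC B fun v => LinearMap.congr_fun hB v⟩

lemma Good.base (M : Type u) [AddCommGroup M] [Module R M] [Module.Finite R M]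
    (N : Submodule R M) : Good I (fun n => M ⧸ (prodPow I n • N : Submodule R M)) := by
  refine ⟨M, inferInstance, inferInstance, inferInstance, fun _ => ⊤, fun n => prodPow I n • N,
    IsAR.const _, ⟨⊥, N, 0, fun n _ => by simp⟩, fun n =>
    ⟨LinearMap.graph (prodPow I n • N : Submodule R M).mkQ, ?_, ?_, ?_, ?_⟩⟩
  · intro x _; exact ⟨(prodPow I n • N : Submodule R M).mkQ x, (LinearMap.mem_graph_iff _ _).2 rfl⟩
  · intro _ _ _; trivial
  · intro y
    obtain ⟨x, rfl⟩ := Submodule.Quotient.mk_surjective _ y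
    exact ⟨x, (LinearMap.mem_graph_iff _ _).2 rfl⟩
  · rintro x y hy
    rw [LinearMap.mem_graph_iff] at hy
    change y = _ at hy
    rw [hy, Submodule.mkQ_apply, Submodule.Quotient.mk_eq_zero]

lemma Good.stable {X : (Fin r → ℕ) → Type u} [∀ n, AddCommGroup (X n)]
    [∀ n, Module R (X n)] (h : Good I X) :
    ∃ c, (∀ n, c ≤ n → Subsingleton (X n)) ∨ (∀ n, c ≤ n → ¬ Subsingleton (X n)) := by
  obtain ⟨E, _, _, _, U, V, hU, hV, h⟩ := h
  choose G hG using h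
  simp only [(hG _).subsingleton_iff]
  exact hU.stable hV

end ARPart

lemma ext_stable {R : Type u} [CommRing R] [IsNoetherianRing R]
    {r : ℕ} (I : Fin r → Ideal R) (J : Ideal R) {X : (Fin r → ℕ) → Type u}
    [∀ n, AddCommGroup (X n)] [∀ n, Module R (X n)] (h : Good I X) (i : ℕ) :
    ∃ c, (∀ n, c ≤ n → Subsingleton
        (Abelian.Ext (ModuleCat.of R (R ⧸ J)) (ModuleCat.of R (X n)) i)) ∨
      (∀ n, c ≤ n → ¬ Subsingleton
        (Abelian.Ext (ModuleCat.of R (R ⧸ J)) (ModuleCat.of R (X n)) i)) := by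
  obtain ⟨P, _, _, _, Q, _, _, _, g, hg⟩ := ext_eq_coherent (R := R) i (R ⧸ J)
  obtain ⟨c, hc⟩ := (h.coherent I g).stable
  refine ⟨c, ?_⟩
  simp only [hg]
  exact hc

lemma gradeIdeal_eq {R : Type u} [CommRing R] (J : Ideal R) (X : Type u) [AddCommGroup X]
    [Module R X] : gradeIdeal J X = sInf {n : ℕ∞ | ∃ m : ℕ, n = m ∧
    ¬ Subsingleton (Abelian.Ext (ModuleCat.of R (R ⧸ J)) (ModuleCat.of R X) m)} := by
  unfold gradeIdeal
  simp only [old_ext_iff, not_subsingleton_iff_nontrivial]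

lemma grade_stable {R : Type u} [CommRing R] [IsNoetherianRing R]
    {r : ℕ} (I : Fin r → Ideal R) (J : Ideal R) {X : (Fin r → ℕ) → Type u}
    [∀ n, AddCommGroup (X n)] [∀ n, Module R (X n)] [∀ n, Module.Finite R (X n)]
    (h : Good I X) :
    ∃ (c : Fin r → ℕ) (t : ℕ∞), ∀ n, c ≤ n → gradeIdeal J (X n) = t := by
  classical
  choose c hc using fun i => ext_stable I J h i
  by_cases hex : ∃ i, ∀ n, c i ≤ n → ¬ Subsingleton
        (Abelian.Ext (ModuleCat.of R (R ⧸ J)) (ModuleCat.of R (X n)) i)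
  · refine ⟨(Finset.range (Nat.find hex + 1)).sup c, (Nat.find hex : ℕ), fun n hn => ?_⟩
    have hle : ∀ i ≤ Nat.find hex, c i ≤ n := fun i hi =>
      (Finset.le_sup (f := c) (Finset.mem_range.2 (by lia))).trans hn
    rw [gradeIdeal_eq]
    apply le_antisymm
    · exact sInf_le ⟨_, rfl, Nat.find_spec hex n (hle _ le_rfl)⟩
    · refine le_sInf ?_
      rintro _ ⟨m, rfl, hm⟩
      rw [Nat.cast_le]
      refine not_lt.1 fun hlt => ?_
      rcases hc m with h1 | h1
      · exact hm (h1 n (hle m hlt.le))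
      · exact Nat.find_min hex hlt h1
  · obtain ⟨d, hd⟩ := kill_of_ext_vanish J
    refine ⟨(Finset.range (d + 1)).sup c, ⊤, fun n hn => ?_⟩
    have hle : ∀ i ≤ d, c i ≤ n := fun i hi =>
      (Finset.le_sup (f := c) (Finset.mem_range.2 (by lia))).trans hn
    obtain ⟨a, ha, hax⟩ := hd (X n) fun i hi => by
      rcases hc i with h1 | h1
      · exact h1 n (hle i hi)
      · exact absurd ⟨i, h1⟩ hex
    rw [gradeIdeal_eq, sInf_eq_top]
    rintro _ ⟨m, rfl, hm⟩
    exact absurd (ext_vanish_of_kill J (X n) a ha hax m) hm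

/-- asymptotic stability of `grade(J, F(M / I^n N))`. -/
theorem stmt1 {R : Type u} [CommRing R] [IsNoetherianRing R]
    {r : ℕ} (hr : 1 ≤ r) (I : Fin r → Ideal R)
    (J : Ideal R) (hJ : J ≠ ⊥)
    (M : Type u) [AddCommGroup M] [Module R M] [Module.Finite R M]
    (N : Submodule R M)
    {K L : Type u} [AddCommGroup K] [Module R K] [Module.Finite R K]
    [AddCommGroup L] [Module R L] [Module.Finite R L]
    (f : K →ₗ[R] L) :
    ∃ c : Fin r → ℕ, ∀ n : Fin r → ℕ, c ≤ n →
      gradeIdeal J (coherentApply f (M ⧸ (prodPow I n • N : Submodule R M))) =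
      gradeIdeal J (coherentApply f (M ⧸ (prodPow I c • N : Submodule R M))) := by
  obtain ⟨c, t, h⟩ := grade_stable I J ((Good.base I M N).coherent I f)
  refine ⟨c, fun n hn => ?_⟩
  exact (h n hn).trans (h c le_rfl).symm
end

section
/- Let R be a commutative Noetherian ring and r ≥ 1. Let S = ⊕_{n∈ℕ^r} S_n be a Noetherian standard ℕ^r-graded ring with S_0 = R, and let ℳ = ⊕_{n∈ℤ^r} ℳ_n be a finitely generated ℤ^r-graded S-module. Let f : K → L be an R-linear map between finitely generated R-modules and let F denote the associated coherent functor, F(X) := Hom_R(K,X) / {g ∘ f : g ∈ Hom_R(L,X)}. Then the set of associated primes Ass_R(F(ℳ_n)) stabilizes: there exists c ∈ ℕ^r such that Ass_R(F(ℳ_n)) = Ass_R(F(ℳ_c)) for all n ∈ ℤ^r with n ≥ c. -/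
lemma mem_ass_iff' {R M : Type*} [CommRing R] [IsNoetherianRing R] [AddCommGroup M] [Module R M]
    (P : Ideal R) : P ∈ associatedPrimes R M ↔ P.IsPrime ∧ ∃ x : M, ∀ a, a ∈ P ↔ a • x = 0 := by
  rw [AssociatedPrimes.mem_iff, isAssociatedPrime_iff]
  refine and_congr Iff.rfl (exists_congr fun x => ?_)
  rw [SetLike.ext_iff]
  simp [Submodule.mem_colon_singleton]

lemma ass_finite_of_finite {R S N : Type*} [CommRing R] [IsNoetherianRing R] [CommRing S]
    [Algebra R S] [IsNoetherianRing S] [AddCommGroup N] [Module R N] [Module S N]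
    [IsScalarTower R S N] [Module.Finite S N] : (associatedPrimes R N).Finite := by
  refine ((associatedPrimes.finite S N).image (Ideal.comap (algebraMap R S))).subset ?_
  intro P hP
  rw [mem_ass_iff'] at hP
  obtain ⟨hPp, x, hx⟩ := hP
  let T : Submodule S N := Submodule.span S {x}
  have hcomap : (Module.annihilator S T).comap (algebraMap R S) = P := by
    ext a
    rw [hx, Ideal.mem_comap, Submodule.mem_annihilator_span_singleton, algebraMap_smul]
  have hmin : P ∈ ((Module.annihilator S T).comap (algebraMap R S)).minimalPrimes := by
    rw [hcomap, Ideal.minimalPrimes_eq_subsingleton_self]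
    rfl
  obtain ⟨Q, hQ, hQP⟩ := Ideal.exists_minimalPrimes_comap_eq _ _ hmin
  refine ⟨Q, ?_, hQP⟩
  have h1 := Module.associatedPrimes.minimalPrimes_annihilator_subset_associatedPrimes S T hQ
  exact associatedPrimes.subset_of_injective T.injective_subtype h1

lemma graded_ass_stable {R : Type*} [CommRing R] [IsNoetherianRing R]
    {r : ℕ} (S : Type*) [CommRing S] [Algebra R S] [IsNoetherianRing S]
    (𝒜 : (Fin r → ℕ) → Submodule R S) [GradedAlgebra 𝒜]
    (hstd : ∀ n : Fin r → ℕ, 𝒜 n = ∏ i, 𝒜 (Pi.single i 1) ^ n i)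
    (N : Type*) [AddCommGroup N] [Module R N] [Module S N]
    [IsScalarTower R S N] [Module.Finite S N]
    (𝒩 : (Fin r → ℤ) → Submodule R N) (p : (Fin r → ℤ) → N →ₗ[R] N)
    (hp1 : ∀ n, ∀ x ∈ 𝒩 n, p n x = x) (hp2 : ∀ m n, m ≠ n → ∀ x ∈ 𝒩 m, p n x = 0)
    (hsmul : ∀ (m : Fin r → ℕ) (n : Fin r → ℤ) (s : S) (x : N),
      s ∈ 𝒜 m → x ∈ 𝒩 n → s • x ∈ 𝒩 (fun i => n i + m i)) :
    ∃ c : Fin r → ℕ, ∀ n : Fin r → ℤ, (fun i => (c i : ℤ)) ≤ n →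
      associatedPrimes R (𝒩 n) = associatedPrimes R (𝒩 (fun i => (c i : ℤ))) := by
  classical
  have : IsNoetherian S N := isNoetherian_of_isNoetherianRing_of_finite S N
  -- positive degree in direction i lies in the ideal generated by degree e_i
  have hideal : ∀ i (m : Fin r → ℕ), m i ≠ 0 → ∀ s ∈ 𝒜 m,
      s ∈ Ideal.span (𝒜 (Pi.single i 1) : Set S) := by
    intro i m hm s hs
    rw [hstd, ← Finset.prod_erase_mul _ _ (Finset.mem_univ i)] at hs
    obtain ⟨k, hk⟩ := Nat.exists_eq_succ_of_ne_zero hm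
    rw [hk, pow_succ, ← mul_assoc] at hs
    induction hs using Submodule.mul_induction_on' with
    | mem_mul_mem a ha b hb => exact Ideal.mul_mem_left _ _ (Ideal.subset_span hb)
    | add a ha b hb h1 h2 => exact add_mem h1 h2
  -- bound
  have hbound : ∀ i, ∃ b : ℕ, ∀ n : Fin r → ℤ, (b : ℤ) ≤ n i → ∀ x ∈ 𝒩 n,
      (∀ s ∈ 𝒜 (Pi.single i 1), s • x = 0) → x = 0 := by
    intro i
    let Z : Set N := {x | (∃ n, x ∈ 𝒩 n) ∧ ∀ s ∈ 𝒜 (Pi.single i 1), s • x = 0}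
    obtain ⟨T, hTZ, hT⟩ := (Submodule.fg_span_iff_fg_span_finset_subset Z).1
      (IsNoetherian.noetherian (Submodule.span S Z))
    have hd : ∀ t : N, ∃ n, t ∈ T → t ∈ 𝒩 n := by
      intro t
      by_cases ht : t ∈ T
      · obtain ⟨n, hn⟩ := (hTZ ht).1
        exact ⟨n, fun _ => hn⟩
      · exact ⟨0, fun h => absurd h ht⟩
    choose d hd using hd
    refine ⟨T.sup (fun t => (d t i).toNat + 1), fun n hn x hx hsx => ?_⟩
    have hxZ : x ∈ Submodule.span S (T : Set N) := by
      rw [← hT]; exact Submodule.subset_span ⟨⟨n, hx⟩, hsx⟩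
    have key : ∀ s : S, p n (s • x) = 0 := by
      clear hsx hx
      induction hxZ using Submodule.span_induction with
      | zero => simp
      | add a b _ _ ha hb => intro s; rw [smul_add, map_add, ha, hb, add_zero]
      | smul a b _ hb => intro s; rw [smul_smul]; exact hb _
      | mem t ht =>
        intro s
        induction s using DirectSum.Decomposition.inductionOn 𝒜 with
        | zero => simp
        | add a b ha hb => rw [add_smul, map_add, ha, hb, add_zero]
        | @homogeneous m s =>
          by_cases hm : m i = 0
          · refine hp2 _ _ ?_ _ (hsmul m (d t) s t s.2 (hd t ht))
            intro h
            have h1 := congrFun h i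
            have h2 : (d t i).toNat + 1 ≤ T.sup (fun t => (d t i).toNat + 1) :=
              Finset.le_sup (f := fun t => (d t i).toNat + 1) ht
            simp only [hm] at h1
            omega
          · have h0 : (s : S) ∈ Ideal.span (𝒜 (Pi.single i 1) : Set S) := hideal i m hm s s.2
            have h1 : (s : S) • t = 0 := by
              have h2 : Ideal.span (𝒜 (Pi.single i 1) : Set S) ≤
                  LinearMap.ker (LinearMap.toSpanSingleton S N t) := by
                rw [Ideal.span_le]
                intro a ha
                simpa using (hTZ ht).2 a ha
              simpa using h2 h0
            rw [h1, map_zero]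
    have := key 1
    rwa [one_smul, hp1 n x hx] at this
  choose b hb using hbound
  -- one step monotonicity
  have step : ∀ i (n : Fin r → ℤ), (b i : ℤ) ≤ n i →
      associatedPrimes R (𝒩 n) ⊆ associatedPrimes R (𝒩 (n + Pi.single i 1)) := by
    intro i n hn P hP
    rw [mem_ass_iff'] at hP ⊢
    obtain ⟨hPp, x, hx⟩ := hP
    refine ⟨hPp, ?_⟩
    obtain ⟨T, hTA, hT⟩ := (Submodule.fg_span_iff_fg_span_finset_subset
      (𝒜 (Pi.single i 1) : Set S)).1 (IsNoetherian.noetherian (Submodule.span S _))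
    have hle : T.inf (fun s => LinearMap.ker
        ((LinearMap.toSpanSingleton R N (s • (x : N))))) ≤ P := by
      intro a ha
      rw [Submodule.mem_finsetInf] at ha
      rw [hx]
      apply Subtype.ext
      refine hb i n hn _ (a • x).2 fun s hs => ?_
      have hsT : s ∈ Submodule.span S (T : Set S) := hT ▸ Submodule.subset_span hs
      have h2 : Submodule.span S (T : Set S) ≤
          LinearMap.ker (LinearMap.toSpanSingleton S N ((a • x : 𝒩 n) : N)) := by
        rw [Submodule.span_le]
        intro t ht
        have := ha t ht
        simp only [LinearMap.mem_ker, LinearMap.toSpanSingleton_apply] at this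
        simp only [SetLike.mem_coe, LinearMap.mem_ker, LinearMap.toSpanSingleton_apply,
          Submodule.coe_smul]
        rw [← algebraMap_smul S a (x : N), smul_smul, mul_comm, ← smul_smul, algebraMap_smul, this]
      simpa using h2 hsT
    obtain ⟨s, hsT, hs⟩ := hPp.inf_le'.1 hle
    have hmem : s • (x : N) ∈ 𝒩 (n + Pi.single i 1) := by
      have := hsmul _ n s x (hTA hsT) x.2
      convert this using 2
      ext j
      by_cases hj : j = i
      · subst hj; simp
      · simp [hj]
    refine ⟨⟨s • (x : N), hmem⟩, fun a => ⟨fun ha => ?_, fun ha => ?_⟩⟩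
    · rw [hx] at ha
      apply Subtype.ext
      have h3 : a • (x : N) = 0 := congrArg Subtype.val ha
      simp only [Submodule.coe_smul, Submodule.coe_zero]
      rw [← algebraMap_smul S a (s • (x : N)), smul_smul, mul_comm, ← smul_smul, algebraMap_smul,
        h3, smul_zero]
    · apply hs
      simpa using congrArg Subtype.val ha
  -- iterate in one direction
  have stepk : ∀ i (k : ℕ) (n : Fin r → ℤ), (b i : ℤ) ≤ n i →
      associatedPrimes R (𝒩 n) ⊆ associatedPrimes R (𝒩 (n + Pi.single i (k : ℤ))) := by
    intro i k
    induction k with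
    | zero => intro n _; rw [Nat.cast_zero, Pi.single_zero, add_zero]
    | succ k ih =>
      intro n hn
      refine (ih n hn).trans ?_
      have := step i (n + Pi.single i (k : ℤ)) (by simp; omega)
      rwa [add_assoc, ← Pi.single_add, ← Nat.cast_succ] at this
  have mono : ∀ m n : Fin r → ℤ, (fun i => (b i : ℤ)) ≤ m → m ≤ n →
      associatedPrimes R (𝒩 m) ⊆ associatedPrimes R (𝒩 n) := by
    intro m n hm hmn
    have h : ∀ s : Finset (Fin r), associatedPrimes R (𝒩 m) ⊆
        associatedPrimes R (𝒩 (fun i => if i ∈ s then n i else m i)) := by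
      intro s
      induction s using Finset.induction_on with
      | empty =>
        have h1 : (fun i => if i ∈ (∅ : Finset (Fin r)) then n i else m i) = m := by ext i; simp
        rw [h1]
      | insert a s ha ih =>
        refine ih.trans ?_
        have := stepk a (n a - m a).toNat (fun i => if i ∈ s then n i else m i)
          (by simp only [ha, if_false]; exact hm a)
        have h1 : (fun i => if i ∈ insert a s then n i else m i) =
            (fun i => if i ∈ s then n i else m i) + Pi.single a (((n a - m a).toNat : ℕ) : ℤ) := by
          ext j
          have h2 : m a ≤ n a := hmn a
          by_cases hj : j = a
          · subst hj
            simp only [Finset.mem_insert_self, if_true, Pi.add_apply, ha, if_false,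
              Pi.single_eq_same]
            omega
          · simp [hj]
        rwa [h1]
    have h1 : (fun i => if i ∈ (Finset.univ : Finset (Fin r)) then n i else m i) = n := by
      ext i; simp
    have h2 := h Finset.univ
    rwa [h1] at h2
  -- conclude by finiteness
  have hfin : (associatedPrimes R N).Finite := ass_finite_of_finite (S := S)
  have hsub : ∀ n, associatedPrimes R (𝒩 n) ⊆ associatedPrimes R N := fun n =>
    associatedPrimes.subset_of_injective (𝒩 n).injective_subtype
  have hw : ∀ P : Ideal R, ∃ w : Fin r → ℕ, b ≤ w ∧
      ∀ n : Fin r → ℤ, (fun i => (b i : ℤ)) ≤ n → P ∈ associatedPrimes R (𝒩 n) →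
        P ∈ associatedPrimes R (𝒩 (fun i => (w i : ℤ))) := by
    intro P
    by_cases h : ∃ n : Fin r → ℤ, (fun i => (b i : ℤ)) ≤ n ∧ P ∈ associatedPrimes R (𝒩 n)
    · obtain ⟨n, hn, hP⟩ := h
      have hn' : (fun i => ((n i).toNat : ℤ)) = n := by
        ext i; have : (b i : ℤ) ≤ n i := hn i; omega
      refine ⟨fun i => (n i).toNat, fun i => ?_, fun _ _ _ => ?_⟩
      · have : (b i : ℤ) ≤ n i := hn i
        show b i ≤ (n i).toNat
        omega
      · rwa [hn']
    · exact ⟨b, le_rfl, fun n hn hP => absurd ⟨n, hn, hP⟩ h⟩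
  choose w hbw hw using hw
  let c : Fin r → ℕ := b ⊔ hfin.toFinset.sup w
  have hbc : (fun i => (b i : ℤ)) ≤ fun i => (c i : ℤ) := fun i => by
    have : b i ≤ c i := (le_sup_left : b ≤ c) i
    exact Int.ofNat_le.2 this
  refine ⟨c, fun n hn => Set.Subset.antisymm (fun P hP => ?_) (mono _ _ hbc hn)⟩
  refine mono _ _ ?_ ?_ (hw P n (hbc.trans hn) hP)
  · intro i; exact Int.ofNat_le.2 (hbw P i)
  · intro i
    have h1 : w P ≤ hfin.toFinset.sup w := Finset.le_sup (by simpa using hsub n hP)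
    have : w P i ≤ c i := (h1.trans le_sup_right) i
    exact Int.ofNat_le.2 this


universe u

/-- asymptotic stability of `Ass_R (F(ℳ_n))` for a finitely generated
`ℤ^r`-graded module `ℳ` over a Noetherian standard `ℕ^r`-graded ring `S` with `S_0 = R`. -/
theorem stmt3 {R : Type u} [CommRing R] [IsNoetherianRing R]
    {r : ℕ} (hr : 1 ≤ r)
    -- the Noetherian standard ℕ^r-graded ring S with S₀ = R
    (S : Type u) [CommRing S] [Algebra R S] [IsNoetherianRing S]
    (hinj : Function.Injective (algebraMap R S))
    (𝒜 : (Fin r → ℕ) → Submodule R S) [GradedAlgebra 𝒜]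
    (h0 : 𝒜 0 = 1)
    (hstd : ∀ n : Fin r → ℕ, 𝒜 n = ∏ i, 𝒜 (Pi.single i 1) ^ n i)
    -- the finitely generated ℤ^r-graded S-module ℳ with components ℬ n
    (ℳ : Type u) [AddCommGroup ℳ] [Module R ℳ] [Module S ℳ]
    [IsScalarTower R S ℳ] [Module.Finite S ℳ]
    (ℬ : (Fin r → ℤ) → Submodule R ℳ) (hdec : DirectSum.Decomposition ℬ)
    (hsmul : ∀ (m : Fin r → ℕ) (n : Fin r → ℤ) (s : S) (x : ℳ),
      s ∈ 𝒜 m → x ∈ ℬ n → s • x ∈ ℬ (fun i => n i + m i))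
    -- the coherent functor
    {K L : Type u} [AddCommGroup K] [Module R K] [Module.Finite R K]
    [AddCommGroup L] [Module R L] [Module.Finite R L]
    (f : K →ₗ[R] L) :
    ∃ c : Fin r → ℕ, ∀ n : Fin r → ℤ, (fun i => (c i : ℤ)) ≤ n →
      associatedPrimes R (coherentApply f (ℬ n)) =
      associatedPrimes R (coherentApply f (ℬ (fun i => (c i : ℤ)))) := by
  classical
  have hcomm : SMulCommClass R S ℳ := inferInstance
  have : IsNoetherian S ℳ := isNoetherian_of_isNoetherianRing_of_finite S ℳ
  -- `Hom_R(K, ℳ)` is a finite S-module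
  have hfinH : Module.Finite S (K →ₗ[R] ℳ) := by
    obtain ⟨k, g, hg⟩ := Module.Finite.exists_fin' R K
    let φ : (K →ₗ[R] ℳ) →ₗ[S] (Fin k → ℳ) :=
      { toFun := fun h j => h (g (Pi.single j 1))
        map_add' := fun _ _ => rfl
        map_smul' := fun _ _ => rfl }
    refine Module.Finite.of_injective φ fun h1 h2 h => ?_
    have : h1 ∘ₗ g = h2 ∘ₗ g := by
      apply LinearMap.pi_ext'
      intro j
      apply LinearMap.ext_ring
      exact congrFun h j
    ext y
    obtain ⟨z, rfl⟩ := hg y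
    exact LinearMap.congr_fun this z
  let ψ : (L →ₗ[R] ℳ) →ₗ[S] (K →ₗ[R] ℳ) :=
    { toFun := fun h => h ∘ₗ f
      map_add' := fun _ _ => rfl
      map_smul' := fun _ _ => rfl }
  let B : Submodule S (K →ₗ[R] ℳ) := LinearMap.range ψ
  have hB : ∀ h, h ∈ B ↔ ∃ g : L →ₗ[R] ℳ, g ∘ₗ f = h := fun h => Iff.rfl
  -- projections
  let π : (n : Fin r → ℤ) → ℳ →ₗ[R] ℬ n := fun n =>
    DirectSum.component R _ _ n ∘ₗ (DirectSum.decomposeLinearEquiv ℬ).toLinearMap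
  have hπ1 : ∀ n (x : ℬ n), π n x = x := fun n x => by
    exact Subtype.ext (DirectSum.decompose_of_mem_same ℬ x.2)
  have hπ2 : ∀ m n, m ≠ n → ∀ x : ℬ m, π n x = 0 := fun m n hmn x => by
    simp only [π, LinearMap.comp_apply]
    exact Subtype.ext (DirectSum.decompose_of_mem_ne ℬ x.2 hmn)
  -- the maps F(ℬ n) → N
  let j : (n : Fin r → ℤ) → coherentApply f (ℬ n) →ₗ[R] ((K →ₗ[R] ℳ) ⧸ B) := fun n =>
    Submodule.liftQ _ ((B.mkQ.restrictScalars R) ∘ₗ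
      ((ℬ n).subtype.compRight R : (K →ₗ[R] ℬ n) →ₗ[R] (K →ₗ[R] ℳ))) (by
        rintro _ ⟨h, rfl⟩
        simp only [LinearMap.mem_ker, LinearMap.comp_apply, LinearMap.coe_restrictScalars,
          Submodule.mkQ_apply, Submodule.Quotient.mk_eq_zero]
        exact ⟨(ℬ n).subtype ∘ₗ h, rfl⟩)
  have hj : ∀ n (g : K →ₗ[R] ℬ n), j n (Submodule.Quotient.mk g) =
      Submodule.Quotient.mk ((ℬ n).subtype ∘ₗ g) := fun _ _ => rfl
  have hjinj : ∀ n, Function.Injective (j n) := by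
    intro n
    rw [injective_iff_map_eq_zero]
    intro x hx
    obtain ⟨g, rfl⟩ := Submodule.Quotient.mk_surjective _ x
    rw [hj, Submodule.Quotient.mk_eq_zero, hB] at hx
    obtain ⟨h, hh⟩ := hx
    rw [Submodule.Quotient.mk_eq_zero]
    refine ⟨π n ∘ₗ h, ?_⟩
    ext y
    have h1 : h (f y) = (g y : ℳ) := LinearMap.congr_fun hh y
    have h2 : π n (h (f y)) = g y := by rw [h1, hπ1]
    exact congrArg Subtype.val h2
  let q : (n : Fin r → ℤ) → ℳ →ₗ[R] ℳ := fun n => (ℬ n).subtype ∘ₗ π n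
  let p : (n : Fin r → ℤ) → ((K →ₗ[R] ℳ) ⧸ B) →ₗ[R] ((K →ₗ[R] ℳ) ⧸ B) := fun n =>
    Submodule.mapQ (B.restrictScalars R) (B.restrictScalars R)
      ((q n).compRight R : (K →ₗ[R] ℳ) →ₗ[R] (K →ₗ[R] ℳ)) (by
        rintro _ ⟨h, rfl⟩
        exact ⟨q n ∘ₗ h, rfl⟩)
  have hp : ∀ n (g : K →ₗ[R] ℳ), p n (Submodule.Quotient.mk g) =
      Submodule.Quotient.mk (q n ∘ₗ g) := fun _ _ => rfl
  obtain ⟨c, hc⟩ := graded_ass_stable S 𝒜 hstd ((K →ₗ[R] ℳ) ⧸ B)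
    (fun n => LinearMap.range (j n)) p
    (by
      rintro n _ ⟨x, rfl⟩
      obtain ⟨g, rfl⟩ := Submodule.Quotient.mk_surjective _ x
      rw [hj, hp]
      congr 1
      ext y
      exact congrArg Subtype.val (hπ1 n (g y)))
    (by
      rintro m n hmn _ ⟨x, rfl⟩
      obtain ⟨g, rfl⟩ := Submodule.Quotient.mk_surjective _ x
      rw [hj, hp]
      have : q n ∘ₗ (ℬ m).subtype ∘ₗ g = 0 := by
        ext y
        exact congrArg Subtype.val (hπ2 m n hmn (g y))
      rw [this]
      rfl)
    (by
      rintro m n s _ hs ⟨x, rfl⟩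
      obtain ⟨g, rfl⟩ := Submodule.Quotient.mk_surjective _ x
      rw [hj, ← Submodule.Quotient.mk_smul]
      let g' : K →ₗ[R] ℬ (fun i => n i + m i) :=
        (s • ((ℬ n).subtype ∘ₗ g)).codRestrict _ (fun y => hsmul m n s _ hs (g y).2)
      exact ⟨Submodule.Quotient.mk g', rfl⟩)
  refine ⟨c, fun n hn => ?_⟩
  rw [LinearEquiv.AssociatedPrimes.eq (LinearEquiv.ofInjective (j n) (hjinj n)), hc n hn,
    ← LinearEquiv.AssociatedPrimes.eq (LinearEquiv.ofInjective (j _) (hjinj _))]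
end

section
/- Let R be a commutative Noetherian ring and r ≥ 1. Let S = ⊕_{n∈ℕ^r} S_n be a Noetherian standard ℕ^r-graded ring with S_0 = R, and let ℳ = ⊕_{n∈ℤ^r} ℳ_n be a finitely generated ℤ^r-graded S-module. Let f : K → L be an R-linear map between finitely generated R-modules and let F denote the associated coherent functor, F(X) := Hom_R(K,X) / {g ∘ f : g ∈ Hom_R(L,X)}. If the length λ_R(F(ℳ_n)) is finite for all n ≫ 0, then there exist c ∈ ℕ^r and a polynomial P ∈ ℚ[x_1,…,x_r] such that λ_R(F(ℳ_n)) = P(n) for all n ∈ ℤ^r with n ≥ c. -/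
universe u

/-- The length `λ_R(X)` of an `R`-module `X`, as the supremum of lengths of chains
of submodules of `X` (an element of `WithBot ℕ∞`; it is `⊤` iff `X` has infinite
length). -/
noncomputable def moduleLength (R X : Type u) [CommRing R] [AddCommGroup X]
    [Module R X] : WithBot ℕ∞ :=
  Order.krullDim (Submodule R X)


namespace HP

/-- one variable functions: zero for small `n`, polynomial for large `n`. -/
def E1 (g : ℤ → ℚ) : Prop :=
  (∃ b : ℤ, ∀ n < b, g n = 0) ∧ ∃ (p : Polynomial ℚ) (d : ℤ), ∀ n ≥ d, g n = p.eval (n : ℚ)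

lemma poly_antidiff (p : Polynomial ℚ) : ∃ q : Polynomial ℚ, ∀ x : ℚ,
    q.eval x - q.eval (x - 1) = p.eval x := by
  induction p using Polynomial.induction_on' with
  | add p q hp hq =>
    obtain ⟨a, ha⟩ := hp
    obtain ⟨b, hb⟩ := hq
    refine ⟨a + b, fun x => ?_⟩
    simp only [Polynomial.eval_add, ← ha, ← hb]
    ring
  | monomial k c =>
    refine ⟨Polynomial.C (c / (k + 1)) * (Polynomial.bernoulli (k + 1)).comp (1 + Polynomial.X), fun x => ?_⟩
    have h := Polynomial.bernoulli_eval_one_add (k + 1) x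
    have hk : (k : ℚ) + 1 ≠ 0 := by positivity
    simp only [Polynomial.eval_mul, Polynomial.eval_C, Polynomial.eval_comp, Polynomial.eval_add,
      Polynomial.eval_one, Polynomial.eval_X, Polynomial.eval_monomial, h]
    rw [show (1 : ℚ) + (x - 1) = x by ring]
    rw [Nat.add_sub_cancel]
    push_cast
    field_simp
    ring

lemma E1.antidiff {g : ℤ → ℚ} (hg : E1 g) : ∃ G, E1 G ∧ ∀ n, G n - G (n - 1) = g n := by
  obtain ⟨⟨b, hb⟩, p, d, hd⟩ := hg
  obtain ⟨q, hq⟩ := poly_antidiff p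
  have key : ∀ n, ∑ k ∈ Finset.Icc b n, g k - ∑ k ∈ Finset.Icc b (n - 1), g k = g n := by
    intro n
    by_cases h : b ≤ n
    · have : Finset.Icc b n = insert n (Finset.Icc b (n - 1)) := by
        ext k; simp only [Finset.mem_Icc, Finset.mem_insert]; omega
      rw [this, Finset.sum_insert (by simp)]
      ring
    · rw [Finset.Icc_eq_empty (by omega), Finset.Icc_eq_empty (by omega), hb n (by omega)]
      simp
  refine ⟨fun n => ∑ k ∈ Finset.Icc b n, g k, ⟨⟨b, ?_⟩, ?_⟩, key⟩
  · intro n hn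
    simp only
    rw [Finset.Icc_eq_empty (by omega), Finset.sum_empty]
  · refine ⟨q + Polynomial.C (∑ k ∈ Finset.Icc b d, g k - q.eval (d : ℚ)), d, ?_⟩
    intro n hn
    simp only [Polynomial.eval_add, Polynomial.eval_C]
    induction n, hn using Int.leInduction with
    | base => ring
    | succ n hn ih =>
      have h1 := key (n + 1)
      have h2 := hq ((n : ℚ) + 1)
      rw [hd (n + 1) (by omega)] at h1
      push_cast at h1 ⊢
      rw [add_sub_cancel_right] at h1 h2
      linarith

/-- The span of products of one variable functions. -/
def GG (r : ℕ) : Submodule ℚ ((Fin r → ℤ) → ℚ) :=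
  Submodule.span ℚ {h | ∃ g : Fin r → ℤ → ℚ, (∀ i, E1 (g i)) ∧ h = fun n => ∏ i, g i (n i)}

lemma GG_single {r : ℕ} (a : Fin r → ℤ) : (fun n => if n = a then (1 : ℚ) else 0) ∈ GG r := by
  refine Submodule.subset_span ⟨fun i k => if k = a i then 1 else 0, fun i => ⟨⟨a i, ?_⟩, 0, a i + 1, ?_⟩, ?_⟩
  · intro n hn; simp [hn.ne]
  · intro n hn; simp only; rw [if_neg (by omega)]; simp
  · funext n
    rw [Finset.prod_ite_zero]
    simp [funext_iff]

lemma GG_fin {r : ℕ} (h : (Fin r → ℤ) → ℚ) (s : Finset (Fin r → ℤ)) (hs : ∀ n ∉ s, h n = 0) :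
    h ∈ GG r := by
  have : h = ∑ a ∈ s, h a • (fun n => if n = a then (1 : ℚ) else 0) := by
    funext n
    simp only [Finset.sum_apply, Pi.smul_apply, smul_eq_mul, mul_ite, mul_one, mul_zero,
      Finset.sum_ite_eq]
    split_ifs with hn
    · rfl
    · exact hs n hn
  rw [this]
  exact Submodule.sum_mem _ fun a _ => Submodule.smul_mem _ _ (GG_single a)

lemma E1.shift {g : ℤ → ℚ} (hg : E1 g) (t : ℤ) : E1 (fun n => g (n - t)) := by
  obtain ⟨⟨b, hb⟩, p, d, hd⟩ := hg
  refine ⟨⟨b + t, fun n hn => hb _ (by omega)⟩, p.comp (Polynomial.X - Polynomial.C (t : ℚ)), d + t, ?_⟩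
  intro n hn
  simp only
  rw [hd _ (by omega)]
  simp

lemma GG_shift {r : ℕ} {h : (Fin r → ℤ) → ℚ} (hh : h ∈ GG r) (t : Fin r → ℤ) :
    (fun n => h (n - t)) ∈ GG r := by
  induction hh using Submodule.span_induction with
  | mem h hx =>
    obtain ⟨g, hg, rfl⟩ := hx
    exact Submodule.subset_span ⟨fun i k => g i (k - t i), fun i => (hg i).shift _, rfl⟩
  | zero => exact Submodule.zero_mem _
  | add x y _ _ hx hy => exact Submodule.add_mem _ hx hy
  | smul a x _ hx => exact Submodule.smul_mem _ a hx

/-- bounded below -/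
def BB {r : ℕ} (h : (Fin r → ℤ) → ℚ) : Prop := ∃ c : Fin r → ℤ, ∀ n, ¬ c ≤ n → h n = 0

lemma GG_BB {r : ℕ} {h : (Fin r → ℤ) → ℚ} (hh : h ∈ GG r) : BB h := by
  induction hh using Submodule.span_induction with
  | mem h hx =>
    obtain ⟨g, hg, rfl⟩ := hx
    choose b hb using fun i => (hg i).1
    refine ⟨b, fun n hn => ?_⟩
    rw [Pi.le_def] at hn
    push Not at hn
    obtain ⟨i, hi⟩ := hn
    exact Finset.prod_eq_zero (Finset.mem_univ i) (hb i _ hi)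
  | zero => exact ⟨0, fun _ _ => rfl⟩
  | add x y _ _ hx hy =>
    obtain ⟨c, hc⟩ := hx
    obtain ⟨d, hd⟩ := hy
    refine ⟨c ⊓ d, fun n hn => ?_⟩
    rw [Pi.add_apply, hc n fun h => hn (inf_le_left.trans h),
      hd n fun h => hn (inf_le_right.trans h), add_zero]
  | smul a x _ hx =>
    obtain ⟨c, hc⟩ := hx
    exact ⟨c, fun n hn => by simp [hc n hn]⟩

lemma GG_antidiff {r : ℕ} {h : (Fin r → ℤ) → ℚ} (hh : h ∈ GG r) (i : Fin r) :
    ∃ H ∈ GG r, ∀ n, H n - H (n - Pi.single i 1) = h n := by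
  induction hh using Submodule.span_induction with
  | mem h hx =>
    obtain ⟨g, hg, rfl⟩ := hx
    obtain ⟨G, hG, hGg⟩ := (hg i).antidiff
    refine ⟨_, Submodule.subset_span ⟨Function.update g i G, ?_, rfl⟩, ?_⟩
    · intro j
      by_cases hj : j = i
      · subst hj; simpa using hG
      · simpa [hj] using hg j
    · intro n
      beta_reduce
      rw [← Finset.mul_prod_erase _ _ (Finset.mem_univ i), ← Finset.mul_prod_erase _ _ (Finset.mem_univ i),
        ← Finset.mul_prod_erase _ _ (Finset.mem_univ i)]
      have e1 : ∏ x ∈ Finset.univ.erase i, Function.update g i G x (n x)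
          = ∏ x ∈ Finset.univ.erase i, g x (n x) := by
        refine Finset.prod_congr rfl fun x hx => ?_
        simp [Finset.ne_of_mem_erase hx]
      have e2 : ∏ x ∈ Finset.univ.erase i, Function.update g i G x ((n - Pi.single i 1 : Fin r → ℤ) x)
          = ∏ x ∈ Finset.univ.erase i, g x (n x) := by
        refine Finset.prod_congr rfl fun x hx => ?_
        simp [Finset.ne_of_mem_erase hx]
      rw [e1, e2, ← hGg]
      simp
      ring
  | zero => exact ⟨0, Submodule.zero_mem _, by simp⟩
  | add x y _ _ hx hy =>
    obtain ⟨H, hH, hx⟩ := hx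
    obtain ⟨H', hH', hy⟩ := hy
    refine ⟨H + H', Submodule.add_mem _ hH hH', fun n => ?_⟩
    simp only [Pi.add_apply, ← hx, ← hy]; ring
  | smul a x _ hx =>
    obtain ⟨H, hH, hx⟩ := hx
    refine ⟨a • H, Submodule.smul_mem _ a hH, fun n => ?_⟩
    simp only [Pi.smul_apply, smul_eq_mul, ← hx]; ring

lemma GG_of_diff {r : ℕ} {h : (Fin r → ℤ) → ℚ} (hb : BB h) (i : Fin r)
    (hd : (fun n => h n - h (n - Pi.single i 1)) ∈ GG r) : h ∈ GG r := by
  obtain ⟨H, hH, hdiff⟩ := GG_antidiff hd i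
  obtain ⟨c, hc⟩ := hb
  obtain ⟨d, hd'⟩ := GG_BB hH
  have step : ∀ n, h n - H n = h (n - Pi.single i 1) - H (n - Pi.single i 1) := fun n => by
    have := hdiff n
    linarith
  have stepk : ∀ (k : ℕ) n, h n - H n = h (n - Pi.single i (k : ℤ)) - H (n - Pi.single i (k : ℤ)) := by
    intro k
    induction k with
    | zero => intro n; simp
    | succ k ih =>
      intro n
      rw [ih n, step]
      have : n - Pi.single i (k : ℤ) - Pi.single i 1 = n - Pi.single i ((k + 1 : ℕ) : ℤ) := by
        push_cast
        rw [Pi.single_add]; abel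
      rw [this]
  have : h = H := by
    funext n
    have h1 := stepk ((n i - c i).toNat + (n i - d i).toNat + 1) n
    rw [hc (n - _) fun hle => ?_, hd' (n - _) fun hle => ?_] at h1
    · linarith
    · have := hle i
      simp at this
      omega
    · have := hle i
      simp at this
      omega
  rwa [this]

lemma GG_poly {r : ℕ} {h : (Fin r → ℤ) → ℚ} (hh : h ∈ GG r) :
    ∃ (c : Fin r → ℤ) (P : MvPolynomial (Fin r) ℚ), ∀ n, c ≤ n →
      h n = MvPolynomial.eval (fun i => (n i : ℚ)) P := by
  induction hh using Submodule.span_induction with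
  | mem h hx =>
    obtain ⟨g, hg, rfl⟩ := hx
    choose p d hd using fun i => (hg i).2
    refine ⟨d, ∏ i, Polynomial.aeval (MvPolynomial.X i) (p i), fun n hn => ?_⟩
    rw [map_prod]
    refine Finset.prod_congr rfl fun i _ => ?_
    rw [hd i _ (hn i)]
    rw [← MvPolynomial.coe_aeval_eq_eval, RingHom.coe_coe, ← Polynomial.aeval_algHom_apply]
    simp [Polynomial.aeval_def, Polynomial.eval₂_eq_eval_map]
  | zero => exact ⟨0, 0, by simp⟩
  | add x y _ _ hx hy =>
    obtain ⟨c, P, hc⟩ := hx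
    obtain ⟨d, Q, hd⟩ := hy
    refine ⟨c ⊔ d, P + Q, fun n hn => ?_⟩
    rw [Pi.add_apply, hc n (le_sup_left.trans hn), hd n (le_sup_right.trans hn), map_add]
  | smul a x _ hx =>
    obtain ⟨c, P, hc⟩ := hx
    exact ⟨c, MvPolynomial.C a * P, fun n hn => by simp [hc n hn]⟩


section rl
variable {R V : Type u} [CommRing R] [AddCommGroup V] [Module R V]

lemma mem_so {A B : Submodule R V} {b : B} : b ∈ A.submoduleOf B ↔ (b : V) ∈ A := Iff.rfl

/-- relative length -/
noncomputable def rl (A B : Submodule R V) : ℕ∞ := Module.length R (B ⧸ A.submoduleOf B)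

lemma rl_eq {A B : Submodule R V} {W : Type u} [AddCommGroup W] [Module R W] (g : B →ₗ[R] W)
    (hg : Function.Surjective g) (hk : ∀ b : B, g b = 0 ↔ (b : V) ∈ A) :
    rl A B = Module.length R W := by
  have h : A.submoduleOf B = LinearMap.ker g := by
    ext b
    rw [LinearMap.mem_ker, hk, mem_so]
  unfold rl
  rw [h]
  exact (g.quotKerEquivOfSurjective hg).length_eq

lemma rl_add {A C B : Submodule R V} (hAC : A ≤ C) (hCB : C ≤ B) :
    rl A B = rl A C + rl C B := by
  have hle : A.submoduleOf B ≤ C.submoduleOf B := fun b hb => hAC hb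
  set N := (C.submoduleOf B).map (A.submoduleOf B).mkQ with hN
  have h1 : rl A B = Module.length R N + Module.length R ((B ⧸ A.submoduleOf B) ⧸ N) :=
    Module.length_eq_add_of_exact N.subtype N.mkQ N.injective_subtype N.mkQ_surjective
      (LinearMap.exact_subtype_mkQ N)
  have h2 : Module.length R ((B ⧸ A.submoduleOf B) ⧸ N) = rl C B :=
    (Submodule.quotientQuotientEquivQuotient _ _ hle).length_eq
  have h3 : rl A C = Module.length R N := by
    refine rl_eq (LinearMap.codRestrict N ((A.submoduleOf B).mkQ ∘ₗ Submodule.inclusion hCB) ?_) ?_ ?_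
    · intro c
      exact ⟨Submodule.inclusion hCB c, c.2, rfl⟩
    · rintro ⟨_, b, hb, rfl⟩
      exact ⟨⟨b, hb⟩, rfl⟩
    · intro c
      rw [← Submodule.coe_eq_zero]
      change (A.submoduleOf B).mkQ (Submodule.inclusion hCB c) = 0 ↔ _
      rw [Submodule.mkQ_apply, Submodule.Quotient.mk_eq_zero, mem_so]
      rfl
  rw [h1, h2, h3]

lemma rl_zero {A B : Submodule R V} (h : B ≤ A) : rl A B = 0 := by
  have : A.submoduleOf B = ⊤ := by
    rw [eq_top_iff]
    exact fun b _ => h b.2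
  unfold rl
  rw [this]
  exact Module.length_eq_zero
end rl

section graded
variable {R S V : Type u} [CommRing R] [CommRing S] [Algebra R S] [AddCommGroup V] [Module R V]
  [Module S V] [IsScalarTower R S V] {r : ℕ}

/-- A system of projections compatible with a grading of `S`. -/
structure PS (𝒜 : (Fin r → ℕ) → Submodule R S) (π : (Fin r → ℤ) → V →ₗ[R] V) : Prop where
  idem : ∀ n v, π n (π n v) = π n v
  orth : ∀ m n v, m ≠ n → π m (π n v) = 0
  fin : ∀ v, ∃ s : Finset (Fin r → ℤ), ∀ n ∉ s, π n v = 0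
  smul : ∀ (m : Fin r → ℕ) (n : Fin r → ℤ) (s : S) (v : V), s ∈ 𝒜 m →
    π n (s • v) = s • π (n - fun i => (m i : ℤ)) v

/-- degree `n` piece of a submodule -/
def pc (π : (Fin r → ℤ) → V →ₗ[R] V) (A : Submodule S V) (n : Fin r → ℤ) : Submodule R V where
  carrier := {v | v ∈ A ∧ π n v = v}
  add_mem' := by
    rintro a b ⟨ha, ha'⟩ ⟨hb, hb'⟩
    exact ⟨A.add_mem ha hb, by rw [map_add, ha', hb']⟩
  zero_mem' := ⟨A.zero_mem, map_zero _⟩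
  smul_mem' := by
    rintro c a ⟨ha, ha'⟩
    exact ⟨(A.restrictScalars R).smul_mem c ha, by rw [map_smul, ha']⟩

lemma mem_pc {π : (Fin r → ℤ) → V →ₗ[R] V} {A : Submodule S V} {n : Fin r → ℤ} {v : V} :
    v ∈ pc π A n ↔ v ∈ A ∧ π n v = v := Iff.rfl

/-- homogeneous submodules -/
def Hom (π : (Fin r → ℤ) → V →ₗ[R] V) (A : Submodule S V) : Prop := ∀ v ∈ A, ∀ n, π n v ∈ A

lemma pc_mono (π : (Fin r → ℤ) → V →ₗ[R] V) {A B : Submodule S V} (h : A ≤ B) (n : Fin r → ℤ) :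
    pc π A n ≤ pc π B n := fun _ hv => ⟨h hv.1, hv.2⟩

/-- truncation -/
def trunc (𝒜 : (Fin r → ℕ) → Submodule R S) [GradedAlgebra 𝒜] {π : (Fin r → ℤ) → V →ₗ[R] V}
    (hπ : PS 𝒜 π) (c : Fin r → ℤ) : Submodule S V where
  carrier := {v | ∀ n, ¬ c ≤ n → π n v = 0}
  add_mem' := by
    intro a b ha hb n hn
    rw [map_add, ha n hn, hb n hn, add_zero]
  zero_mem' := fun n _ => map_zero _
  smul_mem' := by
    intro s v hv
    induction s using DirectSum.Decomposition.inductionOn 𝒜 with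
    | zero => intro n _; simp
    | @homogeneous m s =>
      intro n hn
      rw [hπ.smul m n s v s.2, hv, smul_zero]
      intro h
      apply hn
      refine h.trans ?_
      intro i
      simp
    | add a b ha hb =>
      intro n hn
      rw [add_smul, map_add, ha n hn, hb n hn, add_zero]

variable (𝒜 : (Fin r → ℕ) → Submodule R S)

lemma base [GradedAlgebra 𝒜] [IsNoetherian S V] {π : (Fin r → ℤ) → V →ₗ[R] V} (hπ : PS 𝒜 π) (h0 : 𝒜 0 = 1)
    (I : Ideal S) (hI : ∀ m ≠ 0, ∀ s ∈ 𝒜 m, s ∈ I) (A B : Submodule S V)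
    (hA : Hom π A) (hIB : ∀ s ∈ I, ∀ b ∈ B, s • b ∈ A) :
    ∃ s : Finset (Fin r → ℤ), ∀ n ∉ s, pc π B n ≤ pc π A n := by
  classical
  obtain ⟨T, hT⟩ := IsNoetherian.noetherian B
  choose d hd using hπ.fin
  refine ⟨T.biUnion d, fun n hn v hv => ⟨?_, hv.2⟩⟩
  have key : ∀ v ∈ Submodule.span S (T : Set V),
      v ∈ A.restrictScalars R ⊔ Submodule.span R (T : Set V) := by
    intro v hv
    have hle : ∀ (s : S), ∀ t ∈ T, s • t ∈ A.restrictScalars R ⊔ Submodule.span R (T : Set V) := by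
      intro s t ht
      induction s using DirectSum.Decomposition.inductionOn 𝒜 with
      | zero => simp
      | @homogeneous m s =>
        by_cases hm : m = 0
        · subst hm
          obtain ⟨s, hs⟩ := s
          rw [h0] at hs
          obtain ⟨a, rfl⟩ := Submodule.mem_one.1 hs
          simp only [algebraMap_smul]
          exact Submodule.mem_sup_right (Submodule.smul_mem _ _ (Submodule.subset_span ht))
        · refine Submodule.mem_sup_left (hIB _ (hI m hm _ s.2) t ?_)
          rw [← hT]
          exact Submodule.subset_span ht
      | add a b ha hb => rw [add_smul]; exact Submodule.add_mem _ ha hb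
    rw [← Set.image_id (T : Set V), Submodule.mem_span_image_iff_exists_fun] at hv
    obtain ⟨t, ht, c, rfl⟩ := hv
    exact Submodule.sum_mem _ fun i _ => hle _ _ (ht i.2)
  have hv1 := hv.1
  rw [← hT] at hv1
  obtain ⟨a, ha, t, ht, hat⟩ := Submodule.mem_sup.1 (key v hv1)
  have ht0 : π n t = 0 := by
    have : Submodule.span R (T : Set V) ≤ LinearMap.ker (π n) := by
      rw [Submodule.span_le]
      intro t ht
      exact hd t n fun h => hn (Finset.mem_biUnion.2 ⟨t, ht, h⟩)
    exact this ht
  rw [← hv.2, ← hat, map_add, ht0, add_zero]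
  exact hA a ha n

/-- the Hilbert function -/
noncomputable def hf (π : (Fin r → ℤ) → V →ₗ[R] V) (A B : Submodule S V) (n : Fin r → ℤ) : ℚ :=
  ((rl (pc π A n) (pc π B n)).toNat : ℚ)

lemma main_step {π : (Fin r → ℤ) → V →ₗ[R] V} (hπ : PS 𝒜 π) (i : Fin r) (x : S)
    (hx : x ∈ 𝒜 (Pi.single i 1)) (A B : Submodule S V) (hA : Hom π A) (hB : Hom π B)
    (n : Fin r → ℤ) :
    rl (pc π (A.comap (LinearMap.lsmul S V x) ⊓ B) (n - Pi.single i 1)) (pc π B (n - Pi.single i 1)) =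
    rl (pc π A n) (pc π (A ⊔ B.map (LinearMap.lsmul S V x)) n) := by
  have hs : ∀ v, π n (x • v) = x • π (n - Pi.single i 1) v := by
    intro v
    rw [hπ.smul _ n x v hx]
    congr 3
    funext j
    by_cases h : j = i
    · subst h; simp
    · simp [h]
  set e := n - Pi.single i 1
  let m : pc π B e →ₗ[R] pc π (A ⊔ B.map (LinearMap.lsmul S V x)) n :=
    { toFun := fun b => ⟨x • (b : V), Submodule.mem_sup_right ⟨b, b.2.1, rfl⟩, by rw [hs, b.2.2]⟩
      map_add' := fun a b => by ext; simp
      map_smul' := fun a b => by ext; exact smul_comm x a (b : V) }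
  refine rl_eq ((Submodule.mkQ _) ∘ₗ m) ?_ ?_
  · intro q
    obtain ⟨⟨v, hv, hv'⟩, rfl⟩ := Submodule.mkQ_surjective _ q
    obtain ⟨a, ha, _, ⟨b, hb, rfl⟩, hab⟩ := Submodule.mem_sup.1 hv
    refine ⟨⟨π e b, hB b hb e, hπ.idem e b⟩, ?_⟩
    simp only [LinearMap.comp_apply, Submodule.mkQ_apply]
    rw [Submodule.Quotient.eq, mem_so]
    have : x • π e b - v = - π n a := by
      rw [← hv', ← hab, map_add]
      simp [hs]
    change x • π e b - v ∈ _
    rw [this]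
    exact Submodule.neg_mem _ ⟨hA a ha n, hπ.idem n a⟩
  · rintro ⟨b, hb⟩
    rw [LinearMap.comp_apply, Submodule.mkQ_apply, Submodule.Quotient.mk_eq_zero,
      mem_so]
    constructor
    · rintro ⟨h, -⟩
      exact ⟨⟨h, hb.1⟩, hb.2⟩
    · rintro ⟨⟨h, -⟩, -⟩
      exact ⟨h, by change π n (x • b) = x • b; rw [hs, hb.2]⟩

lemma main_ind [GradedAlgebra 𝒜] [IsNoetherian S V] {π : (Fin r → ℤ) → V →ₗ[R] V} (hπ : PS 𝒜 π) (h0 : 𝒜 0 = 1)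
    (G : Set S) (hG : ∀ x ∈ G, ∃ i, x ∈ 𝒜 (Pi.single i 1))
    (hI : ∀ m ≠ 0, ∀ s ∈ 𝒜 m, s ∈ Ideal.span G) (c : Fin r → ℤ) (l : List S) (hl : ∀ x ∈ l, x ∈ G) :
    ∀ A B : Submodule S V, Hom π A → Hom π B → A ≤ B → B ≤ trunc 𝒜 hπ c →
      (∀ n, rl (pc π A n) (pc π B n) ≠ ⊤) → (∀ x ∈ G, x ∉ l → ∀ b ∈ B, x • b ∈ A) →
      hf π A B ∈ GG r := by
  induction l with
  | nil =>
    intro A B hA hB hAB hBc hfin hk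
    obtain ⟨s, hs⟩ := base 𝒜 hπ h0 (Ideal.span G) hI A B hA (by
      intro s hs b hb
      induction hs using Submodule.span_induction with
      | mem x hx => exact hk x hx (by simp) b hb
      | zero => simp
      | add x y _ _ hx hy => rw [add_smul]; exact A.add_mem hx hy
      | smul a x _ hx => rw [smul_assoc]; exact A.smul_mem a hx)
    refine GG_fin _ s fun n hn => ?_
    simp [hf, rl_zero (hs n hn)]
  | cons x l ih =>
    intro A B hA hB hAB hBc hfin hk
    have ih := ih fun y hy => hl y (List.mem_cons_of_mem _ hy)
    obtain ⟨i, hx⟩ := hG x (hl x (by simp))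
    have step := main_step 𝒜 hπ i x hx A B hA hB
    set K := A.comap (LinearMap.lsmul S V x) ⊓ B with hK
    set C := A ⊔ B.map (LinearMap.lsmul S V x) with hC
    have hAK : A ≤ K := le_inf (fun a ha => A.smul_mem x ha) hAB
    have hKB : K ≤ B := inf_le_right
    have hAC : A ≤ C := le_sup_left
    have hCB : C ≤ B := sup_le hAB (by rintro _ ⟨b, hb, rfl⟩; exact B.smul_mem x hb)
    have add1 := fun n => rl_add (pc_mono π hAK n) (pc_mono π hKB n)
    have add2 := fun n => rl_add (pc_mono π hAC n) (pc_mono π hCB n)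
    have hHK : Hom π K := by
      rintro v ⟨hv, hvB⟩ n
      refine ⟨?_, hB v hvB n⟩
      have := hA _ hv (n + fun j => ((Pi.single i 1 : Fin r → ℕ) j : ℤ))
      rw [LinearMap.lsmul_apply, hπ.smul _ _ x v hx, add_sub_cancel_right] at this
      exact this
    have hHC : Hom π C := by
      intro v hv n
      obtain ⟨a, ha, _, ⟨b, hb, rfl⟩, rfl⟩ := Submodule.mem_sup.1 hv
      rw [map_add, LinearMap.lsmul_apply, hπ.smul _ _ x b hx]
      exact Submodule.add_mem _ (Submodule.mem_sup_left (hA a ha n))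
        (Submodule.mem_sup_right ⟨_, hB b hb _, rfl⟩)
    have fK : ∀ n, rl (pc π A n) (pc π K n) ≠ ⊤ := fun n h => hfin n (by rw [add1, h, top_add])
    have fK' : ∀ n, rl (pc π K n) (pc π B n) ≠ ⊤ := fun n h => hfin n (by rw [add1, h, add_top])
    have fC : ∀ n, rl (pc π C n) (pc π B n) ≠ ⊤ := fun n h => hfin n (by rw [add2, h, add_top])
    have fC' : ∀ n, rl (pc π A n) (pc π C n) ≠ ⊤ := fun n h => hfin n (by rw [add2, h, top_add])
    have gK : hf π A K ∈ GG r := ih A K hA hHK hAK (hKB.trans hBc) fK (by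
      intro y hy hyl b hb
      by_cases hyx : y = x
      · subst hyx; exact hb.1
      · exact hk y hy (by simp [hyx, hyl]) b hb.2)
    have gC : hf π C B ∈ GG r := ih C B hHC hB hCB hBc fC (by
      intro y hy hyl b hb
      by_cases hyx : y = x
      · subst hyx; exact Submodule.mem_sup_right ⟨b, hb, rfl⟩
      · exact hAC (hk y hy (by simp [hyx, hyl]) b hb))
    refine GG_of_diff ⟨c, fun n hn => ?_⟩ i ?_
    · have : pc π B n ≤ pc π A n := by
        intro v hv
        have := hBc hv.1 n hn
        rw [hv.2] at this
        rw [this]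
        exact Submodule.zero_mem _
      simp [hf, rl_zero this]
    · convert Submodule.sub_mem _ gC (GG_shift gK (Pi.single i 1)) using 1
      funext n
      simp only [hf, Pi.sub_apply]
      rw [add1 (n - Pi.single i 1), add2 n, ENat.toNat_add (fK _) (fK' _),
        ENat.toNat_add (fC' _) (fC _), step]
      push_cast
      ring

end graded

section final
variable {R S : Type u} [CommRing R] [CommRing S] [Algebra R S] {r : ℕ}

lemma exists_gens [IsNoetherianRing S] (𝒜 : (Fin r → ℕ) → Submodule R S) 
    (hstd : ∀ n : Fin r → ℕ, 𝒜 n = ∏ i, 𝒜 (Pi.single i 1) ^ n i) :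
    ∃ G : Finset S, (∀ x ∈ G, ∃ i, x ∈ 𝒜 (Pi.single i 1)) ∧
      ∀ m ≠ 0, ∀ s ∈ 𝒜 m, s ∈ Ideal.span (G : Set S) := by
  obtain ⟨G, hG, hsp⟩ := (Submodule.fg_span_iff_fg_span_finset_subset
    (R := S) {x : S | ∃ i, x ∈ 𝒜 (Pi.single i 1)}).1 (IsNoetherian.noetherian _)
  refine ⟨G, hG, fun m hm s hs => ?_⟩
  rw [Ideal.span, ← hsp]
  obtain ⟨i, hi⟩ : ∃ i, m i ≠ 0 := by
    by_contra h
    push Not at h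
    exact hm (funext h)
  rw [hstd, ← Finset.mul_prod_erase _ _ (Finset.mem_univ i),
    ← Nat.succ_pred_eq_of_ne_zero hi, pow_succ', mul_assoc] at hs
  induction hs using Submodule.mul_induction_on' with
  | mem_mul_mem a ha b hb =>
    rw [mul_comm]
    exact Submodule.smul_mem _ b (Submodule.subset_span ⟨i, ha⟩)
  | add x _ y _ hx hy => exact Submodule.add_mem _ hx hy

variable {M : Type u} [AddCommGroup M] [Module R M] [Module S M] [IsScalarTower R S M]

/-- projections -/
noncomputable def proj (ℬ : (Fin r → ℤ) → Submodule R M) [DirectSum.Decomposition ℬ]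
    (n : Fin r → ℤ) : M →ₗ[R] M :=
  (ℬ n).subtype ∘ₗ DirectSum.component R _ _ n ∘ₗ (DirectSum.decomposeLinearEquiv ℬ).toLinearMap

lemma proj_apply (ℬ : (Fin r → ℤ) → Submodule R M) [DirectSum.Decomposition ℬ]
    (n : Fin r → ℤ) (v : M) : proj ℬ n v = (DirectSum.decompose ℬ v n : M) := rfl

lemma proj_mem (ℬ : (Fin r → ℤ) → Submodule R M) [DirectSum.Decomposition ℬ]
    (n : Fin r → ℤ) (v : M) : proj ℬ n v ∈ ℬ n := by
  rw [proj_apply]; exact Subtype.coe_prop _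

lemma proj_same (ℬ : (Fin r → ℤ) → Submodule R M) [DirectSum.Decomposition ℬ]
    (n : Fin r → ℤ) (v : M) (h : v ∈ ℬ n) : proj ℬ n v = v := by
  rw [proj_apply, DirectSum.decompose_of_mem_same _ h]

lemma proj_ne (ℬ : (Fin r → ℤ) → Submodule R M) [DirectSum.Decomposition ℬ]
    (m n : Fin r → ℤ) (v : M) (h : v ∈ ℬ m) (hmn : m ≠ n) : proj ℬ n v = 0 := by
  rw [proj_apply, DirectSum.decompose_of_mem_ne _ h hmn]

lemma proj_PS (𝒜 : (Fin r → ℕ) → Submodule R S) (ℬ : (Fin r → ℤ) → Submodule R M)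
    [DirectSum.Decomposition ℬ]
    (hsmul : ∀ (m : Fin r → ℕ) (n : Fin r → ℤ) (s : S) (x : M),
      s ∈ 𝒜 m → x ∈ ℬ n → s • x ∈ ℬ (fun i => n i + m i)) : PS 𝒜 (proj ℬ) where
  idem n v := proj_same _ _ _ (proj_mem _ _ _)
  orth m n v h := proj_ne _ n m _ (proj_mem _ _ _) h.symm
  fin v := by
    classical
    refine ⟨(DirectSum.decompose ℬ v).support, fun n hn => ?_⟩
    rw [DFinsupp.notMem_support_iff] at hn
    rw [proj_apply, hn]
    rfl
  smul m n s v hs := by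
    induction v using DirectSum.Decomposition.inductionOn ℬ with
    | zero => simp
    | @homogeneous k v =>
      have h1 := hsmul m k s v hs v.2
      by_cases h : n = fun i => k i + m i
      · subst h
        rw [proj_same _ _ _ h1]
        congr 1
        symm
        apply proj_same
        convert v.2
        funext i
        simp
      · rw [proj_ne _ _ _ _ h1 (Ne.symm h), proj_ne _ k _ _ v.2, smul_zero]
        rintro rfl
        apply h
        funext i
        simp
    | add a b ha hb => rw [smul_add, map_add, ha, hb, map_add, smul_add]

variable {K : Type u} [AddCommGroup K] [Module R K]

/-- projections on Hom -/
noncomputable def hproj (ℬ : (Fin r → ℤ) → Submodule R M) [DirectSum.Decomposition ℬ]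
    (n : Fin r → ℤ) : (K →ₗ[R] M) →ₗ[R] (K →ₗ[R] M) := LinearMap.compRight R (proj ℬ n)

lemma hproj_apply (ℬ : (Fin r → ℤ) → Submodule R M) [DirectSum.Decomposition ℬ]
    (n : Fin r → ℤ) (φ : K →ₗ[R] M) (k : K) : hproj ℬ n φ k = proj ℬ n (φ k) := rfl

lemma hproj_PS [Module.Finite R K] (𝒜 : (Fin r → ℕ) → Submodule R S)
    (ℬ : (Fin r → ℤ) → Submodule R M) [DirectSum.Decomposition ℬ] (h : PS 𝒜 (proj ℬ)) :
    PS 𝒜 (hproj (K := K) ℬ) where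
  idem n v := by ext k; exact h.idem _ _
  orth m n v hmn := by ext k; exact h.orth _ _ _ hmn
  fin φ := by
    classical
    obtain ⟨N, s, hs⟩ := Module.Finite.exists_fin (R := R) (M := K)
    choose d hd using h.fin
    refine ⟨Finset.univ.biUnion fun j => d (φ (s j)), fun n hn => ?_⟩
    refine LinearMap.ext_on_range hs fun j => ?_
    exact hd _ _ fun hj => hn (Finset.mem_biUnion.2 ⟨j, Finset.mem_univ _, hj⟩)
  smul m n s φ hs := by ext k; exact h.smul _ _ _ _ hs

lemma hom_noeth [Module.Finite R K] [IsNoetherianRing S] [Module.Finite S M] :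
    IsNoetherian S (K →ₗ[R] M) := by
  obtain ⟨N, s, hs⟩ := Module.Finite.exists_fin (R := R) (M := K)
  let g : (K →ₗ[R] M) →ₗ[S] (Fin N → M) :=
    { toFun := fun φ j => φ (s j), map_add' := fun _ _ => rfl, map_smul' := fun _ _ => rfl }
  refine isNoetherian_of_injective g ?_
  intro φ ψ h
  exact LinearMap.ext_on_range hs fun j => congrFun h j

end final
end HP

/-- if `λ_R(F(ℳ_n))` is finite for all `n ≫ 0`, then it is eventually given
by a polynomial, where `ℳ` is a finitely generated `ℤ^r`-graded module over a Noetherian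
standard `ℕ^r`-graded ring `S` with `S_0 = R`. -/
theorem stmt5 {R : Type u} [CommRing R] [IsNoetherianRing R]
    {r : ℕ} (hr : 1 ≤ r)
    -- the Noetherian standard ℕ^r-graded ring S with S₀ = R
    (S : Type u) [CommRing S] [Algebra R S] [IsNoetherianRing S]
    (hinj : Function.Injective (algebraMap R S))
    (𝒜 : (Fin r → ℕ) → Submodule R S) [GradedAlgebra 𝒜]
    (h0 : 𝒜 0 = 1)
    (hstd : ∀ n : Fin r → ℕ, 𝒜 n = ∏ i, 𝒜 (Pi.single i 1) ^ n i)
    -- the finitely generated ℤ^r-graded S-module ℳ with components ℬ n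
    (ℳ : Type u) [AddCommGroup ℳ] [Module R ℳ] [Module S ℳ]
    [IsScalarTower R S ℳ] [Module.Finite S ℳ]
    (ℬ : (Fin r → ℤ) → Submodule R ℳ) (hdec : DirectSum.Decomposition ℬ)
    (hsmul : ∀ (m : Fin r → ℕ) (n : Fin r → ℤ) (s : S) (x : ℳ),
      s ∈ 𝒜 m → x ∈ ℬ n → s • x ∈ ℬ (fun i => n i + m i))
    -- the coherent functor
    {K L : Type u} [AddCommGroup K] [Module R K] [Module.Finite R K]
    [AddCommGroup L] [Module R L] [Module.Finite R L]
    (f : K →ₗ[R] L)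
    -- λ_R(F(ℳ_n)) is finite for all n ≫ 0
    (hfin : ∃ c₀ : Fin r → ℕ, ∀ n : Fin r → ℤ, (fun i => (c₀ i : ℤ)) ≤ n →
      moduleLength R (coherentApply f (ℬ n)) ≠ ⊤) :
    ∃ (c : Fin r → ℕ) (P : MvPolynomial (Fin r) ℚ),
      ∀ n : Fin r → ℤ, (fun i => (c i : ℤ)) ≤ n →
        ∃ m : ℕ,
          moduleLength R (coherentApply f (ℬ n)) = m ∧
          (m : ℚ) = MvPolynomial.eval (fun i => (n i : ℚ)) P := by
  classical
  obtain ⟨c₀, hc₀⟩ := hfin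
  obtain ⟨G, hG, hI⟩ := HP.exists_gens 𝒜 hstd
  have hπ := HP.hproj_PS (K := K) 𝒜 ℬ (HP.proj_PS 𝒜 ℬ hsmul)
  have : IsNoetherian S (K →ₗ[R] ℳ) := HP.hom_noeth
  set c : Fin r → ℤ := fun i => (c₀ i : ℤ) with hc
  set B := HP.trunc 𝒜 hπ c with hB
  set A : Submodule S (K →ₗ[R] ℳ) := LinearMap.range (LinearMap.lcomp S ℳ f) with hA
  have hHB : HP.Hom (HP.hproj ℬ) B := by
    intro v hv n m hm
    by_cases h : m = n
    · subst h
      rw [hπ.idem, hv m hm]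
    · exact hπ.orth _ _ _ h
  have hHA : HP.Hom (HP.hproj ℬ) A := by
    rintro _ ⟨g, rfl⟩ n
    exact ⟨HP.proj ℬ n ∘ₗ g, rfl⟩
  have hHAB : HP.Hom (HP.hproj ℬ) (A ⊓ B) := fun v hv n => ⟨hHA v hv.1 n, hHB v hv.2 n⟩
  have hlow : ∀ n, ¬ c ≤ n → HP.rl (HP.pc (HP.hproj ℬ) (A ⊓ B) n) (HP.pc (HP.hproj ℬ) B n) = 0 := by
    intro n hn
    apply HP.rl_zero
    intro v hv
    have := hv.1 n hn
    rw [hv.2] at this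
    rw [this]
    exact Submodule.zero_mem _
  have hlen : ∀ n, c ≤ n → HP.rl (HP.pc (HP.hproj ℬ) (A ⊓ B) n) (HP.pc (HP.hproj ℬ) B n) =
      Module.length R (coherentApply f (ℬ n)) := by
    intro n hn
    have hmem : ∀ φ : HP.pc (HP.hproj (K := K) ℬ) B n, ∀ k, (φ : K →ₗ[R] ℳ) k ∈ ℬ n := by
      intro φ k
      rw [← φ.2.2]
      exact HP.proj_mem _ _ _
    let m : HP.pc (HP.hproj (K := K) ℬ) B n →ₗ[R] (K →ₗ[R] ℬ n) :=
      { toFun := fun φ => LinearMap.codRestrict (ℬ n) (φ : K →ₗ[R] ℳ) (hmem φ)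
        map_add' := fun _ _ => rfl
        map_smul' := fun _ _ => rfl }
    refine HP.rl_eq ((Submodule.mkQ _) ∘ₗ m) ?_ ?_
    · intro q
      obtain ⟨φ, rfl⟩ := Submodule.mkQ_surjective _ q
      have h1 : HP.hproj ℬ n ((ℬ n).subtype ∘ₗ φ) = (ℬ n).subtype ∘ₗ φ := by
        ext k
        exact HP.proj_same _ _ _ (φ k).2
      refine ⟨⟨(ℬ n).subtype ∘ₗ φ, ?_, h1⟩, rfl⟩
      intro j hj
      rw [← h1]
      exact hπ.orth _ _ _ (by rintro rfl; exact hj hn)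
    · intro φ
      rw [LinearMap.comp_apply, Submodule.mkQ_apply, Submodule.Quotient.mk_eq_zero]
      constructor
      · rintro ⟨g, hg⟩
        refine ⟨⟨⟨(ℬ n).subtype ∘ₗ g, ?_⟩, φ.2.1⟩, φ.2.2⟩
        ext k
        exact congrArg Subtype.val (LinearMap.congr_fun hg k)
      · rintro ⟨⟨⟨g, hg⟩, -⟩, -⟩
        refine ⟨LinearMap.codRestrict (ℬ n) (HP.proj ℬ n ∘ₗ g) fun k => HP.proj_mem _ _ _, ?_⟩
        ext k
        change HP.proj ℬ n (g (f k)) = (φ : K →ₗ[R] ℳ) k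
        have h2 : g (f k) = (φ : K →ₗ[R] ℳ) k := LinearMap.congr_fun hg k
        rw [h2]
        exact HP.proj_same _ _ _ (hmem φ k)
  have hne : ∀ n, c ≤ n → Module.length R (coherentApply f (ℬ n)) ≠ ⊤ := by
    intro n hn h
    apply hc₀ n hn
    rw [moduleLength, ← Module.coe_length, h]
    rfl
  have hGG := HP.main_ind 𝒜 hπ h0 (G : Set S) hG hI c G.toList (by simp) (A ⊓ B) B hHAB hHB
    inf_le_right le_rfl (by
      intro n
      by_cases hn : c ≤ n
      · rw [hlen n hn]; exact hne n hn
      · rw [hlow n hn]; simp) (by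
      intro x hx hx'
      exact absurd (Finset.mem_toList.2 hx) hx')
  obtain ⟨d, P, hP⟩ := HP.GG_poly hGG
  refine ⟨fun i => max (c₀ i) (d i).toNat, P, fun n hn => ?_⟩
  have hn' : ∀ i, ((max (c₀ i) (d i).toNat : ℕ) : ℤ) ≤ n i := hn
  have hn1 : c ≤ n := fun i => by
    have h := hn' i
    change (c₀ i : ℤ) ≤ n i
    omega
  have hn2 : d ≤ n := fun i => by
    have h := hn' i
    change d i ≤ n i
    omega
  refine ⟨(Module.length R (coherentApply f (ℬ n))).toNat, ?_, ?_⟩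
  · rw [moduleLength, ← Module.coe_length]
    conv_lhs => rw [← ENat.natCast_toNat (hne n hn1)]
    rfl
  · rw [← hP n hn2, HP.hf, hlen n hn1]
end
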